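/- arXiv:2109.05555 — 8 statements merged into one kernel-verified Lean document; each statement's English description precedes it below -/
import Mathlib

section
/- Let A be an associative unital ℂ-algebra which is left noetherian and of at most countable dimension as a ℂ-vector space, equipped with an increasing filtration F₀ ⊆ F₁ ⊆ F₂ ⊆ ⋯ of ℂ-subspaces such that 1 ∈ F₀, ⋃ᵢ Fᵢ = A, Fᵢ·Fⱼ ⊆ F_{i+j} and [Fᵢ, Fⱼ] ⊆ F_{i+j−1} for all i, j ≥ 0 (with the convention F_k = 0 for k < 0). If PI.deg(A) < ∞, then the Poisson bracket on the associated graded algebra vanishes modulo the nilradical; concretely, for all i, j ≥ 0 and all a ∈ Fᵢ, b ∈ Fⱼ there exists an integer N ≥ 1 such that (ab − ba)^N ∈ F_{N(i+j−1)−1}. -/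
/-- `f` in the free associative `ℤ`-algebra on countably many generators is a
polynomial identity of `A` if every substitution of elements of `A` for the
generators evaluates to `0`. -/
def IsPolyId (A : Type*) [Ring A] (f : FreeAlgebra ℤ ℕ) : Prop :=
  ∀ φ : ℕ → A, FreeAlgebra.lift ℤ φ f = 0

/-- The PI degree of `A`: the supremum (in `ℕ∞`) of all `n ≥ 1` such that every
polynomial identity of `A` is a polynomial identity of `M_n(ℂ)`. -/
noncomputable def PIdeg (A : Type*) [Ring A] : ℕ∞ :=
  ⨆ m ∈ {m : ℕ | 1 ≤ m ∧ ∀ f : FreeAlgebra ℤ ℕ,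
    IsPolyId A f → IsPolyId (Matrix (Fin m) (Fin m) ℂ) f}, (m : ℕ∞)

open Polynomial

/-- Inclusion–exclusion for ordered products of sums: only the surjective choices survive. -/
theorem sum_surjective_prod_ofFn {B : Type*} [Ring B] {l d : ℕ} (g : Fin l → Fin d → B) :
    ∑ κ : Fin l → Fin d with Function.Surjective κ, (List.ofFn fun p => g p (κ p)).prod =
      ∑ t : Finset (Fin d), (-1 : ℤ) ^ t.card • (List.ofFn fun p => ∑ k ∈ tᶜ, g p k).prod := by
  classical
  have h := Finset.inclusion_exclusion_sum_inf_compl (Finset.univ : Finset (Fin d))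
    (fun k => ({κ | ∀ p, κ p ≠ k} : Finset (Fin l → Fin d)))
    (fun κ => (List.ofFn fun p => g p (κ p)).prod)
  have hs : (Finset.univ.inf fun k => ({κ | ∀ p, κ p ≠ k} : Finset (Fin l → Fin d))ᶜ) =
      ({κ | Function.Surjective κ} : Finset (Fin l → Fin d)) := by
    ext κ
    simp only [Finset.mem_inf, Finset.mem_compl, Finset.mem_filter, Finset.mem_univ, true_and,
      true_implies, ne_eq, not_forall, not_not]
    exact Iff.rfl
  rw [hs, Finset.powerset_univ] at h
  rw [h]
  refine Finset.sum_congr rfl fun t _ => ?_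
  congr 1
  have h2 := (MultilinearMap.mkPiAlgebraFin ℤ l B).map_sum_finset g (fun _ => tᶜ)
  simp only [MultilinearMap.mkPiAlgebraFin_apply] at h2
  rw [h2]
  refine Finset.sum_congr ?_ fun _ _ => rfl
  ext κ
  simp only [Finset.mem_inf, Finset.mem_filter, Finset.mem_univ, true_and, Fintype.mem_piFinset,
    Finset.mem_compl]
  exact ⟨fun h p hp => h _ hp p rfl, fun h k hk p hp => h p (hp ▸ hk)⟩

theorem freeAlgebra_lift_eq_sum {B : Type*} [Ring B] (f : FreeAlgebra ℤ ℕ) (φ : ℕ → B) :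
    FreeAlgebra.lift ℤ φ f = (FreeAlgebra.equivMonoidAlgebraFreeMonoid f).coeff.sum
      fun u r => r • (u.toList.map φ).prod := by
  have h : (FreeAlgebra.lift ℤ φ) = ((MonoidAlgebra.lift ℤ B (FreeMonoid ℕ))
      (FreeMonoid.lift φ)).comp
        (FreeAlgebra.equivMonoidAlgebraFreeMonoid (R := ℤ) (X := ℕ)).toAlgHom := by
    ext x
    simp [FreeAlgebra.equivMonoidAlgebraFreeMonoid]
  rw [h]
  simp [MonoidAlgebra.lift_apply, FreeMonoid.lift_apply]

theorem prod_ofFn_ite {B : Type*} [Ring B] {l : ℕ} (q : Fin l → Prop) [DecidablePred q]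
    (z : Fin l → B) :
    (List.ofFn fun p => if q p then z p else 0).prod =
      if ∀ p, q p then (List.ofFn z).prod else 0 := by
  split_ifs with h
  · simp [h]
  · push Not at h
    obtain ⟨p, hp⟩ := h
    apply List.prod_eq_zero
    rw [List.mem_ofFn]
    exact ⟨p, by simp [hp]⟩

/-- Multilinearization: a nonzero polynomial identity of top degree `d` implies a nonzero
multilinear identity of degree `d`. -/
theorem exists_multilinear_identity {f : FreeAlgebra ℤ ℕ} (hf : f ≠ 0) :
    ∃ (d : ℕ) (α : (Fin d → Fin d) → ℤ), α id ≠ 0 ∧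
      ∀ (B : Type*) [Ring B], IsPolyId B f → ∀ z : Fin d → B,
        ∑ κ : Fin d → Fin d with Function.Surjective κ,
          α κ • (List.ofFn fun p => z (κ p)).prod = 0 := by
  classical
  set e := (FreeAlgebra.equivMonoidAlgebraFreeMonoid f).coeff with he
  have he0 : e.support.Nonempty := by
    rw [Finsupp.support_nonempty_iff, he]
    simpa using hf
  obtain ⟨w, hw, hmax⟩ := e.support.exists_max_image (fun u => u.toList.length) he0
  obtain ⟨d, x, rfl⟩ : ∃ (d : ℕ) (x : Fin d → ℕ), w = FreeMonoid.ofList (List.ofFn x) :=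
    ⟨_, w.toList.get, by rw [List.ofFn_get]; rfl⟩
  simp only [FreeMonoid.toList_ofList, List.length_ofFn] at hmax
  refine ⟨d, fun κ => e (FreeMonoid.ofList (List.ofFn fun p => x (κ p))), ?_, ?_⟩
  · simpa using hw
  intro B _ hB z
  let y : Finset (Fin d) → ℕ → B := fun t i => ∑ k ∈ tᶜ, if x k = i then z k else 0
  have key : ∀ u ∈ e.support,
      ∑ t : Finset (Fin d), (-1 : ℤ) ^ t.card • (u.toList.map (y t)).prod =
      ∑ κ : Fin d → Fin d with Function.Surjective κ,
        if (FreeMonoid.ofList (List.ofFn fun p => x (κ p))) = u then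
          (List.ofFn fun p => z (κ p)).prod else 0 := by
    intro u hu
    have hul : u.toList.length ≤ d := hmax u hu
    obtain ⟨l, v, rfl⟩ : ∃ (l : ℕ) (v : Fin l → ℕ), u = FreeMonoid.ofList (List.ofFn v) :=
      ⟨_, u.toList.get, by rw [List.ofFn_get]; rfl⟩
    simp only [FreeMonoid.toList_ofList, List.length_ofFn, List.map_ofFn] at hul ⊢
    have h1 := sum_surjective_prod_ofFn
      (fun (p : Fin l) (k : Fin d) => if x k = v p then z k else 0)
    simp only [Function.comp_def, y]
    rw [← h1]
    rcases hul.lt_or_eq with hlt | heq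
    · rw [Finset.sum_eq_zero, Finset.sum_eq_zero]
      · intro κ _
        rw [if_neg]
        intro h
        have := congrArg List.length (FreeMonoid.ofList.injective h)
        simp at this
        omega
      · intro κ hκ
        have := Fintype.card_le_of_surjective κ (Finset.mem_filter.1 hκ).2
        simp at this
        omega
    · subst heq
      refine Finset.sum_congr rfl fun κ _ => ?_
      rw [prod_ofFn_ite]
      refine if_congr ?_ rfl rfl
      rw [FreeMonoid.ofList.injective.eq_iff, List.ofFn_injective.eq_iff, funext_iff]
  have h0 : ∑ t : Finset (Fin d), (-1 : ℤ) ^ t.card • FreeAlgebra.lift ℤ (y t) f = 0 :=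
    Finset.sum_eq_zero fun t _ => by rw [hB, smul_zero]
  simp only [freeAlgebra_lift_eq_sum, ← he, Finsupp.sum, Finset.smul_sum] at h0
  rw [Finset.sum_comm] at h0
  simp only [smul_comm _ (e _), ← Finset.smul_sum] at h0
  rw [Finset.sum_congr rfl fun u hu => by rw [key u hu]] at h0
  simp only [Finset.smul_sum] at h0
  rw [Finset.sum_comm] at h0
  rw [← h0]
  refine Finset.sum_congr rfl fun κ _ => ?_
  simp only [smul_ite, smul_zero, Finset.sum_ite_eq]
  split_ifs with h
  · rfl
  · rw [Finsupp.notMem_support_iff.1 h, zero_smul]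

theorem eq_zero_of_eval_algebraMap {A : Type*} [Ring A] [Algebra ℂ A] (p : A[X])
    (h : ∀ t : ℂ, p.eval (algebraMap ℂ A t) = 0) : p = 0 := by
  ext n
  rw [coeff_zero, ← Module.forall_dual_apply_eq_zero_iff ℂ]
  intro φ
  have hq : (∑ k ∈ Finset.range (p.natDegree + 1), monomial k (φ (p.coeff k)) : ℂ[X]) = 0 := by
    apply Polynomial.funext
    intro t
    have := congrArg φ (h t)
    rw [eval_eq_sum_range, map_sum, map_zero] at this
    rw [eval_zero, ← this, eval_finsetSum]
    refine Finset.sum_congr rfl fun k _ => ?_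
    rw [eval_monomial, ← map_pow, ← Algebra.commutes, ← Algebra.smul_def, map_smul, smul_eq_mul,
      mul_comm]
  have := congrArg (coeff · n) hq
  simp only [finsetSum_coeff, coeff_monomial, Finset.sum_ite_eq', coeff_zero, Finset.mem_range]
    at this
  split_ifs at this with hn
  · exact this
  · rw [coeff_eq_zero_of_natDegree_lt (by omega), map_zero]

theorem map_freeAlgebra_lift {B C : Type*} [Ring B] [Ring C] (ψ : B →+* C) (φ : ℕ → B)
    (f : FreeAlgebra ℤ ℕ) :
    ψ (FreeAlgebra.lift ℤ φ f) = FreeAlgebra.lift ℤ (fun i => ψ (φ i)) f := by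
  have : (ψ.toIntAlgHom).comp (FreeAlgebra.lift ℤ φ) = FreeAlgebra.lift ℤ (fun i => ψ (φ i)) := by
    ext x
    simp
  exact congrArg (· f) this

theorem IsPolyId.polynomial {A : Type*} [Ring A] [Algebra ℂ A] {f : FreeAlgebra ℤ ℕ}
    (h : IsPolyId A f) : IsPolyId A[X] f := by
  intro φ
  apply eq_zero_of_eval_algebraMap
  intro t
  have := map_freeAlgebra_lift (eval₂RingHom' (RingHom.id A) (algebraMap ℂ A t)
    fun a => (Algebra.commutes t a).symm) φ f
  rw [h] at this
  simpa [eval₂RingHom'] using this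

/-- The iterated commutator `[…[[x, y], y], …, y]` with `k` brackets. -/
def iterComm {A : Type*} [Ring A] (y x : A) (k : ℕ) : A :=
  (fun e => e * y - y * e)^[k] x

theorem iterComm_succ {A : Type*} [Ring A] (y x : A) (k : ℕ) :
    iterComm y x (k + 1) = iterComm y x k * y - y * iterComm y x k :=
  Function.iterate_succ_apply' _ _ _

theorem mul_pow_eq_sum_iterComm {A : Type*} [Ring A] (y x : A) (k : ℕ) :
    x * y ^ k = ∑ l ∈ Finset.range (k + 1), k.choose l • (y ^ l * iterComm y x (k - l)) := by
  let L : Module.End ℤ A := LinearMap.mulLeft ℤ y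
  let R : Module.End ℤ A := LinearMap.mulRight ℤ y
  have hLR : Commute L R := LinearMap.ext fun z => (mul_assoc y z y).symm
  have hc : Commute L (R - L) := hLR.sub_right (Commute.refl L)
  have hR : ∀ n z, (R ^ n) z = z * y ^ n := by
    intro n z
    induction n with
    | zero => simp
    | succ n ih =>
      rw [pow_succ', Module.End.mul_apply, ih, pow_succ, ← mul_assoc]
      rfl
  have hL : ∀ n z, (L ^ n) z = y ^ n * z := by
    intro n z
    induction n with
    | zero => simp
    | succ n ih =>
      rw [pow_succ', Module.End.mul_apply, ih, pow_succ', mul_assoc]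
      rfl
  have hD : ∀ n, ((R - L) ^ n) x = iterComm y x n := by
    intro n
    induction n with
    | zero => simp [iterComm]
    | succ n ih =>
      rw [pow_succ', Module.End.mul_apply, ih, iterComm_succ]
      rfl
  have h := hc.add_pow k
  rw [add_sub_cancel] at h
  have h2 := congrArg (fun T : Module.End ℤ A => T x) h
  simp only [hR] at h2
  rw [h2, LinearMap.sum_apply]
  refine Finset.sum_congr rfl fun l _ => ?_
  rw [← nsmul_eq_mul', LinearMap.smul_apply, Module.End.mul_apply, hD, hL]

theorem iterComm_X_add_C {A : Type*} [Ring A] (y x : A) (k : ℕ) :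
    iterComm (X + C y) (C x) k = C (iterComm y x k) := by
  induction k with
  | zero => rfl
  | succ k ih =>
    rw [iterComm_succ, iterComm_succ, ih, mul_add, add_mul, X_mul_C, C_sub, C_mul, C_mul]
    abel

/-- A `ℤ`-indexed filtration whose associated graded ring is commutative. -/
structure IsCommFiltration {A : Type*} [Ring A] (G : ℤ → AddSubgroup A) : Prop where
  mono : Monotone G
  one_mem : 1 ∈ G 0
  mul_mem : ∀ {k l : ℤ} {a b : A}, a ∈ G k → b ∈ G l → a * b ∈ G (k + l)
  comm_mem : ∀ {k l : ℤ} {a b : A}, a ∈ G k → b ∈ G l → a * b - b * a ∈ G (k + l - 1)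

theorem IsCommFiltration.iterComm_mem {A : Type*} [Ring A] {G : ℤ → AddSubgroup A}
    (hG : IsCommFiltration G) {i j : ℤ} {x y : A} (hx : x ∈ G j) (hy : y ∈ G i) (k : ℕ) :
    iterComm y x k ∈ G (j + k * (i - 1)) := by
  induction k with
  | zero => simpa [iterComm] using hx
  | succ k ih =>
    rw [iterComm_succ]
    convert hG.comm_mem ih hy using 2
    push_cast
    ring

/-- `v` is a polynomial in `X + y` whose coefficients have the filtration degrees of a word in
`n` letters `X + y` and `m` letters `[x, ·]` applied to `1`, the coefficient of index `n - m` having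
leading term `g [x, y] ^ m`. -/
def HasLeadingTerm {A : Type*} [Ring A] (G : ℤ → AddSubgroup A) (i j : ℤ) (x y : A)
    (n m g : ℕ) (v : A[X]) : Prop :=
  ∃ w : ℕ → A, v = ∑ k ∈ Finset.range (n + 1), (X + C y) ^ k * C (w k) ∧
    (∀ k ≤ n, w k ∈ G ((n - k) * i + m * j - max m (n - k))) ∧
    (∀ k, k + m = n → w k - g • (x * y - y * x) ^ m ∈ G (m * i + m * j - m - 1)) ∧
    (n < m → g = 0)

section

variable {A : Type*} [Ring A] {G : ℤ → AddSubgroup A} {i j : ℤ} {x y : A} {n m g : ℕ} {v : A[X]}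

theorem HasLeadingTerm.one (hG : IsCommFiltration G) : HasLeadingTerm G i j x y 0 0 1 1 := by
  refine ⟨fun _ => 1, by simp, ?_, ?_, by simp⟩
  · intro k hk
    obtain rfl : k = 0 := by omega
    simpa using hG.one_mem
  · intro k hk
    simp

theorem HasLeadingTerm.mul_left (h : HasLeadingTerm G i j x y n m g v) :
    HasLeadingTerm G i j x y (n + 1) m g ((X + C y) * v) := by
  obtain ⟨w, rfl, hw, hlead, hg⟩ := h
  refine ⟨fun k => Nat.casesOn k 0 w, ?_, ?_, ?_, fun h => hg (by omega)⟩
  · rw [Finset.sum_range_succ' _ (n + 1), Finset.mul_sum]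
    simp [pow_succ', mul_assoc]
  · rintro (_ | k) hk
    · exact zero_mem _
    · convert hw k (by omega) using 2
      push_cast
      ring_nf
  · rintro (_ | k) hk
    · simp [hg (by omega)]
    · exact hlead k (by omega)

theorem HasLeadingTerm.comm (hG : IsCommFiltration G) (hx : x ∈ G j) (hy : y ∈ G i)
    (h : HasLeadingTerm G i j x y n m g v) :
    HasLeadingTerm G i j x y n (m + 1) ((n - m) * g) (C x * v - v * C x) := by
  obtain ⟨w, rfl, hw, hlead, hg⟩ := h
  have hterm : ∀ k l, k ≤ l → l ≤ n → iterComm y x (l - k) * w l ∈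
      G ((n - k) * i + (m + 1) * j - (l - k) - max m (n - l)) := by
    intro k l hkl hl
    convert hG.mul_mem (hG.iterComm_mem hx hy (l - k)) (hw l hl) using 2
    push_cast [hkl]
    ring
  have hsplit : ∀ k ≤ n, (∑ l ∈ Finset.range (n + 1), l.choose k • (iterComm y x (l - k) * w l)) =
      x * w k + ∑ l ∈ Finset.Ico (k + 1) (n + 1), l.choose k • (iterComm y x (l - k) * w l) := by
    intro k hk
    rw [Finset.range_eq_Ico, ← Finset.sum_Ico_consecutive _ (Nat.zero_le k) (by omega : k ≤ n + 1),
      Finset.sum_eq_zero, zero_add, Finset.sum_eq_sum_Ico_succ_bot (by omega)]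
    · simp [iterComm]
    · intro l hl
      rw [Nat.choose_eq_zero_of_lt (Finset.mem_Ico.1 hl).2, zero_smul]
  refine ⟨fun k => (∑ l ∈ Finset.range (n + 1), l.choose k • (iterComm y x (l - k) * w l)) -
    w k * x, ?_, ?_, ?_, ?_⟩
  · simp only [C_sub, mul_sub, Finset.sum_sub_distrib, Finset.mul_sum, Finset.sum_mul, map_sum,
      C_mul]
    congr 1
    · rw [Finset.sum_comm]
      refine Finset.sum_congr rfl fun l hl => ?_
      rw [← mul_assoc, mul_pow_eq_sum_iterComm, Finset.sum_mul]
      refine Finset.sum_subset_zero_on_sdiff ?_ ?_ ?_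
      · intro k
        simp at hl ⊢
        omega
      · intro k hk
        simp at hk
        rw [Nat.choose_eq_zero_of_lt (by omega)]
        simp
      · intro k _
        simp only [iterComm_X_add_C, nsmul_eq_mul, C_mul, map_natCast]
        rw [(Nat.cast_commute _ _).left_comm]
        simp only [mul_assoc]
    · simp [mul_assoc]
  · intro k hk
    beta_reduce
    rw [hsplit k hk, add_sub_right_comm (x * w k)]
    refine add_mem (hG.mono ?_ (hG.comm_mem hx (hw k hk))) (sum_mem fun l hl => ?_)
    · push_cast
      rw [add_mul]
      omega
    · have hl' := Finset.mem_Ico.1 hl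
      refine nsmul_mem (hG.mono ?_ (hterm k l (by omega) (by omega))) _
      push_cast
      omega
  · intro k hk
    have hkn : (n : ℤ) - k = m + 1 := by omega
    beta_reduce
    rw [hsplit k (by omega), add_sub_right_comm (x * w k), add_sub_assoc (x * w k - w k * x)]
    refine add_mem (hG.mono ?_ (hG.comm_mem hx (hw k (by omega)))) ?_
    · rw [hkn]
      push_cast
      rw [add_mul, add_mul]
      omega
    rw [Finset.sum_eq_sum_Ico_succ_bot (by omega), add_sub_right_comm (_ • _)]
    refine add_mem ?_ (sum_mem fun l hl => ?_)
    · have hc : x * y - y * x ∈ G (j + i - 1) := hG.comm_mem hx hy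
      convert nsmul_mem (hG.mul_mem hc (hlead (k + 1) (by omega))) (k + 1) using 1
      · push_cast
        ring_nf
      · rw [Nat.choose_succ_self_right, Nat.add_sub_cancel_left, iterComm_succ,
          show n - m = k + 1 by omega, mul_sub, smul_sub, mul_smul, pow_succ', mul_smul_comm]
        rfl
    · have hl' := Finset.mem_Ico.1 hl
      refine nsmul_mem (hG.mono ?_ (hterm k l (by omega) (by omega))) _
      rw [hkn]
      push_cast
      omega
  · intro h
    rw [Nat.sub_eq_zero_of_le (by omega), zero_mul]

end

/-- The block `(X + y) ^ (q + 1) [x, ·] ^ q` of operators on `A[X]`. -/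
noncomputable def blockOp {A : Type*} [Ring A] (x y : A) (q : ℕ) : Module.End ℤ A[X] :=
  LinearMap.mulLeft ℤ (X + C y) ^ (q + 1) *
    (LinearMap.mulLeft ℤ (C x) - LinearMap.mulRight ℤ (C x)) ^ q

/-- The leading coefficient of a product of blocks. -/
def blockCoeff : List ℕ → ℕ
  | [] => 1
  | q :: l => l.length.descFactorial q * blockCoeff l

theorem HasLeadingTerm.blockOp_apply {A : Type*} [Ring A] {G : ℤ → AddSubgroup A} {i j : ℤ}
    {x y : A} {n m g : ℕ} {v : A[X]} (hG : IsCommFiltration G) (hx : x ∈ G j) (hy : y ∈ G i)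
    (h : HasLeadingTerm G i j x y n m g v) (q : ℕ) :
    HasLeadingTerm G i j x y (n + (q + 1)) (m + q) ((n - m).descFactorial q * g)
      (blockOp x y q v) := by
  have hcomm : ∀ r, HasLeadingTerm G i j x y n (m + r) ((n - m).descFactorial r * g)
      (((LinearMap.mulLeft ℤ (C x) - LinearMap.mulRight ℤ (C x)) ^ r) v) := by
    intro r
    induction r with
    | zero => simpa using h
    | succ r ih =>
      rw [pow_succ', Module.End.mul_apply, Nat.descFactorial_succ, Nat.sub_sub, mul_assoc]
      exact ih.comm hG hx hy
  have hmul : ∀ r, HasLeadingTerm G i j x y (n + r) (m + q) ((n - m).descFactorial q * g)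
      ((LinearMap.mulLeft ℤ (X + C y) ^ r)
        (((LinearMap.mulLeft ℤ (C x) - LinearMap.mulRight ℤ (C x)) ^ q) v)) := by
    intro r
    induction r with
    | zero => exact hcomm q
    | succ r ih =>
      rw [pow_succ', Module.End.mul_apply]
      exact ih.mul_left
  exact hmul (q + 1)

theorem hasLeadingTerm_prod_blockOp {A : Type*} [Ring A] {G : ℤ → AddSubgroup A} {i j : ℤ}
    {x y : A} (hG : IsCommFiltration G) (hx : x ∈ G j) (hy : y ∈ G i) (l : List ℕ) :
    HasLeadingTerm G i j x y (l.sum + l.length) l.sum (blockCoeff l)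
      ((l.map (blockOp x y)).prod 1) := by
  induction l with
  | nil => exact HasLeadingTerm.one hG
  | cons q l ih =>
    have h := ih.blockOp_apply hG hx hy q
    rw [Nat.add_sub_cancel_left] at h
    have hn : (q :: l).sum + (q :: l).length = l.sum + l.length + (q + 1) := by
      simp only [List.sum_cons, List.length_cons]
      omega
    rw [hn, List.sum_cons, add_comm q l.sum]
    exact h

theorem le_length_of_blockCoeff_ne_zero {l : List ℕ} (h : blockCoeff l ≠ 0) (p : ℕ)
    (hp : p < l.length) : l[p] + p + 1 ≤ l.length := by
  induction l generalizing p with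
  | nil => simp at hp
  | cons q l ih =>
    obtain ⟨h1, h2⟩ := mul_ne_zero_iff.1 h
    rcases p with _ | p
    · have : ¬ l.length < q := fun h => h1 (Nat.descFactorial_eq_zero_iff_lt.2 h)
      simp
      omega
    · have := ih h2 p (by simpa using hp)
      simp
      omega

theorem blockCoeff_ne_zero {l : List ℕ} (h : ∀ (p : ℕ) (hp : p < l.length),
    l[p] + p + 1 ≤ l.length) : blockCoeff l ≠ 0 := by
  induction l with
  | nil => exact one_ne_zero
  | cons q l ih =>
    refine mul_ne_zero ?_ (ih fun p hp => ?_)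
    · have := h 0 (by simp)
      rw [Ne, Nat.descFactorial_eq_zero_iff_lt]
      simp at this
      omega
    · have := h (p + 1) (by simpa using hp)
      simp at this
      omega

/-- Among the surjective arrangements of the blocks `d - 1, …, 0`, only the decreasing one has a
nonzero leading coefficient. -/
theorem blockCoeff_ofFn_ne_zero_iff {d : ℕ} {κ : Fin d → Fin d} (hκ : Function.Surjective κ) :
    blockCoeff (List.ofFn fun p => (d - 1 - κ p : ℕ)) ≠ 0 ↔ κ = id := by
  constructor
  · intro h
    have hle : ∀ p : Fin d, p ≤ κ p := by
      intro p
      have := le_length_of_blockCoeff_ne_zero h p (by simp)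
      simp at this
      rw [Fin.le_def]
      omega
    have hsum : ∑ p, (κ p : ℕ) = ∑ p : Fin d, (p : ℕ) :=
      (Function.Bijective.sum_comp (Finite.injective_iff_bijective.1
        (Finite.injective_iff_surjective.2 hκ)) (fun p : Fin d => (p : ℕ)))
    have := (Finset.sum_eq_sum_iff_of_le fun p (_ : p ∈ Finset.univ) =>
      Fin.le_def.1 (hle p)).1 hsum.symm
    funext p
    exact (Fin.ext (this p (Finset.mem_univ p))).symm
  · rintro rfl
    apply blockCoeff_ne_zero
    intro p hp
    simp at hp ⊢
    omega

theorem eq_zero_of_sum_X_add_C_pow {A : Type*} [Ring A] (y : A) (w : ℕ → A) (n : ℕ)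
    (h : ∑ k ∈ Finset.range n, (X + C y) ^ k * C (w k) = 0) : ∀ k < n, w k = 0 := by
  nontriviality A
  induction n with
  | zero => simp
  | succ n ih =>
    have hn : w n = 0 := by
      have h' := congrArg (coeff · n) h
      simp only [Finset.sum_range_succ, coeff_add, finsetSum_coeff, coeff_mul_C, coeff_zero] at h'
      have hdeg : ∀ k, ((X + C y) ^ k).natDegree = k := fun k => by
        rw [(monic_X_add_C y).natDegree_pow, natDegree_X_add_C, mul_one]
      have hlead : ((X + C y) ^ n).coeff n = 1 := by
        have := ((monic_X_add_C y).pow n).coeff_natDegree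
        rwa [hdeg] at this
      rwa [hlead, one_mul, Finset.sum_eq_zero, zero_add] at h'
      intro k hk
      rw [coeff_eq_zero_of_natDegree_lt, zero_mul]
      rw [hdeg]
      exact Finset.mem_range.1 hk
    intro k hk
    rw [Finset.sum_range_succ, hn, C_0, mul_zero, add_zero] at h
    rcases (Nat.lt_succ_iff.1 hk).lt_or_eq with hlt | rfl
    · exact ih h k hlt
    · exact hn

theorem blockOp_mem_range {A : Type*} [Ring A] (x y : A) :
    ∃ Ψ : A[X][X] →+* Module.End ℤ A[X], ∀ q, ∃ z, Ψ z = blockOp x y q := by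
  refine ⟨eval₂RingHom' (Algebra.lmul ℤ A[X]).toRingHom (LinearMap.mulRight ℤ (C x))
    fun a => LinearMap.ext fun z => (mul_assoc a z (C x)).symm, fun q =>
    ⟨C (X + C y) ^ (q + 1) * (C (C x) - X) ^ q, ?_⟩⟩
  rw [map_mul, map_pow, map_pow, map_sub]
  simp only [eval₂RingHom', RingHom.coe_mk, MonoidHom.coe_mk, OneHom.coe_mk, eval₂_C, eval₂_X]
  rfl

/-- A filtered ring with commutative associated graded ring and a nontrivial identity has
nilpotent Poisson brackets, up to a nonzero integer multiple. -/
theorem exists_zsmul_comm_pow_mem {A : Type*} [Ring A] [Algebra ℂ A] {f : FreeAlgebra ℤ ℕ}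
    (hf : f ≠ 0) (hA : IsPolyId A f) {G : ℤ → AddSubgroup A} (hG : IsCommFiltration G)
    {i j : ℤ} {x y : A} (hx : x ∈ G j) (hy : y ∈ G i) :
    ∃ (r : ℤ) (M : ℕ), r ≠ 0 ∧ r • (x * y - y * x) ^ M ∈ G (M * i + M * j - M - 1) := by
  obtain ⟨d, α, hα, hid⟩ := exists_multilinear_identity hf
  obtain ⟨Ψ, hΨ⟩ := blockOp_mem_range x y
  choose z hz using hΨ
  let l : (Fin d → Fin d) → List ℕ := fun κ => List.ofFn fun p => (d - 1 - κ p : ℕ)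
  let M := ∑ p : Fin d, (d - 1 - p : ℕ)
  have hlen : ∀ κ, (l κ).length = d := fun κ => by simp [l]
  have hsum : ∀ κ, Function.Surjective κ → (l κ).sum = M := fun κ hκ => by
    rw [List.sum_ofFn]
    exact Function.Bijective.sum_comp (Finite.injective_iff_bijective.1
      (Finite.injective_iff_surjective.2 hκ)) (fun p : Fin d => (d - 1 - p : ℕ))
  have hzero := congrArg (fun T => Ψ T 1)
    (hid A[X][X] hA.polynomial.polynomial fun k => z (d - 1 - k))
  have hexp : ∀ κ : Fin d → Fin d, ∃ w : ℕ → A, Function.Surjective κ →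
      ((l κ).map (blockOp x y)).prod 1 =
        ∑ k ∈ Finset.range (M + d + 1), (X + C y) ^ k * C (w k) ∧
      w d - blockCoeff (l κ) • (x * y - y * x) ^ M ∈ G (M * i + M * j - M - 1) := by
    intro κ
    by_cases hκ : Function.Surjective κ
    · obtain ⟨w, h1, -, h2, -⟩ := hasLeadingTerm_prod_blockOp hG hx hy (l κ)
      rw [hsum κ hκ, hlen] at h1 h2
      exact ⟨w, fun _ => ⟨h1, h2 d (add_comm _ _)⟩⟩
    · exact ⟨0, fun h => absurd h hκ⟩
  choose w hw using hexp
  have hW : ∑ κ : Fin d → Fin d with Function.Surjective κ, α κ • w κ d = 0 := by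
    refine eq_zero_of_sum_X_add_C_pow y (fun k => ∑ κ : Fin d → Fin d with Function.Surjective κ,
      α κ • w κ k) (M + d + 1) ?_ d (by omega)
    simp only [map_sum, map_zsmul, LinearMap.sum_apply, LinearMap.smul_apply, map_zero,
      LinearMap.zero_apply, map_list_prod, List.map_ofFn, Function.comp_def, hz] at hzero
    rw [← hzero]
    simp only [map_sum, Finset.mul_sum]
    rw [Finset.sum_comm]
    refine Finset.sum_congr rfl fun κ hκ => ?_
    have := (hw κ (Finset.mem_filter.1 hκ).2).1
    simp only [l, List.map_ofFn, Function.comp_def] at this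
    rw [this, Finset.smul_sum]
    simp only [map_zsmul, mul_smul_comm]
  refine ⟨α id * blockCoeff (l id), M, mul_ne_zero hα (Nat.cast_ne_zero.2
    ((blockCoeff_ofFn_ne_zero_iff Function.surjective_id).2 rfl)), ?_⟩
  have hmem : ∑ κ : Fin d → Fin d with Function.Surjective κ,
      α κ • (w κ d - blockCoeff (l κ) • (x * y - y * x) ^ M) ∈ G (M * i + M * j - M - 1) :=
    sum_mem fun κ hκ => zsmul_mem (hw κ (Finset.mem_filter.1 hκ).2).2 _
  simp only [smul_sub, Finset.sum_sub_distrib] at hmem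
  rw [hW, zero_sub, neg_mem_iff, Finset.sum_eq_single_of_mem id
    (Finset.mem_filter.2 ⟨Finset.mem_univ _, Function.surjective_id⟩)] at hmem
  · rwa [mul_smul, natCast_zsmul]
  · intro κ hκ hne
    have : blockCoeff (l κ) = 0 := not_not.1 fun h =>
      hne ((blockCoeff_ofFn_ne_zero_iff (Finset.mem_filter.1 hκ).2).1 h)
    rw [this, zero_smul, smul_zero]

theorem exists_isPolyId_ne_zero {A : Type*} [Ring A] (h : PIdeg A ≠ ⊤) :
    ∃ f : FreeAlgebra ℤ ℕ, f ≠ 0 ∧ IsPolyId A f := by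
  by_contra! hall
  apply h
  rw [PIdeg, ENat.eq_top_iff_forall_ge]
  intro m
  have hmem : m + 1 ∈ {m : ℕ | 1 ≤ m ∧ ∀ f : FreeAlgebra ℤ ℕ,
      IsPolyId A f → IsPolyId (Matrix (Fin m) (Fin m) ℂ) f} := by
    refine ⟨by omega, fun f hf φ => ?_⟩
    have hf0 : f = 0 := by_contra fun h0 => hall f h0 hf
    rw [hf0, map_zero]
  exact le_trans (by simp) (le_iSup₂ (f := fun (m : ℕ) _ => (m : ℕ∞)) (m + 1) hmem)

/-- The extension by zero of an `ℕ`-indexed filtration to negative indices. -/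
def extendByZero {A : Type*} [Ring A] [Algebra ℂ A] (F : ℕ → Submodule ℂ A) : ℤ → Submodule ℂ A
  | Int.ofNat k => F k
  | Int.negSucc _ => ⊥

theorem extendByZero_of_neg {A : Type*} [Ring A] [Algebra ℂ A] (F : ℕ → Submodule ℂ A) {k : ℤ}
    (hk : k < 0) : extendByZero F k = ⊥ := by
  obtain ⟨n, rfl⟩ := Int.eq_negSucc_of_lt_zero hk
  rfl

theorem eq_zero_of_mem_extendByZero {A : Type*} [Ring A] [Algebra ℂ A] {F : ℕ → Submodule ℂ A}
    {k : ℤ} (hk : k < 0) {a : A} (ha : a ∈ extendByZero F k) : a = 0 := by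
  rwa [extendByZero_of_neg F hk] at ha

theorem isCommFiltration_extendByZero {A : Type*} [Ring A] [Algebra ℂ A]
    {F : ℕ → Submodule ℂ A} (hone : (1 : A) ∈ F 0) (hmono : Monotone F)
    (hmul : ∀ i j : ℕ, ∀ a ∈ F i, ∀ b ∈ F j, a * b ∈ F (i + j))
    (hbr : ∀ i j : ℕ, ∀ a ∈ F i, ∀ b ∈ F j, a * b - b * a ∈ F (i + j - 1))
    (hbr0 : ∀ a ∈ F 0, ∀ b ∈ F 0, a * b = b * a) :
    IsCommFiltration fun k => (extendByZero F k).toAddSubgroup where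
  mono k l hkl a ha := by
    rcases lt_or_ge k 0 with hk | hk
    · obtain rfl := eq_zero_of_mem_extendByZero hk ha
      exact zero_mem _
    · lift k to ℕ using hk
      lift l to ℕ using by omega
      exact hmono (by omega : k ≤ l) ha
  one_mem := hone
  mul_mem {k l a b} ha hb := by
    rcases lt_or_ge k 0 with hk | hk
    · obtain rfl := eq_zero_of_mem_extendByZero hk ha
      simp
    rcases lt_or_ge l 0 with hl | hl
    · obtain rfl := eq_zero_of_mem_extendByZero hl hb
      simp
    lift k to ℕ using hk
    lift l to ℕ using hl
    exact hmul k l a ha b hb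
  comm_mem {k l a b} ha hb := by
    rcases lt_or_ge k 0 with hk | hk
    · obtain rfl := eq_zero_of_mem_extendByZero hk ha
      simp
    rcases lt_or_ge l 0 with hl | hl
    · obtain rfl := eq_zero_of_mem_extendByZero hl hb
      simp
    lift k to ℕ using hk
    lift l to ℕ using hl
    rcases Nat.eq_zero_or_pos (k + l) with h0 | hpos
    · obtain ⟨rfl, rfl⟩ : k = 0 ∧ l = 0 := by omega
      rw [hbr0 a ha b hb, sub_self]
      exact zero_mem _
    · rw [show (k : ℤ) + l - 1 = (k + l - 1 : ℕ) by omega]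
      exact hbr k l a ha b hb

/-- If a left noetherian unital `ℂ`-algebra `A` of at most countable dimension carries a
filtration `F₀ ⊆ F₁ ⊆ ⋯` with `1 ∈ F₀`, `⋃ᵢ Fᵢ = A`, `Fᵢ·Fⱼ ⊆ F_{i+j}` and
`[Fᵢ, Fⱼ] ⊆ F_{i+j-1}` (with `F_k = 0` for `k < 0`), and if `PI.deg(A) < ∞`, then for all
`a ∈ Fᵢ`, `b ∈ Fⱼ` there exists `N ≥ 1` with `(ab - ba)^N ∈ F_{N(i+j-1)-1}`
(interpreted as `(ab - ba)^N = 0` when `N(i+j-1)-1 < 0`). -/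
theorem stmt0 (A : Type*) [Ring A] [Algebra ℂ A]
    (hcount : Module.rank ℂ A ≤ Cardinal.aleph0)
    [IsNoetherianRing A]
    (F : ℕ → Submodule ℂ A)
    (hone : (1 : A) ∈ F 0)
    (hmono : Monotone F)
    (hexh : ∀ a : A, ∃ i, a ∈ F i)
    (hmul : ∀ i j : ℕ, ∀ a ∈ F i, ∀ b ∈ F j, a * b ∈ F (i + j))
    (hbr : ∀ i j : ℕ, ∀ a ∈ F i, ∀ b ∈ F j, a * b - b * a ∈ F (i + j - 1))
    (hbr0 : ∀ a ∈ F 0, ∀ b ∈ F 0, a * b = b * a)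
    (hpi : PIdeg A ≠ ⊤) :
    ∀ i j : ℕ, ∀ a ∈ F i, ∀ b ∈ F j, ∃ N : ℕ, 1 ≤ N ∧
      (((N : ℤ) * ((i : ℤ) + (j : ℤ) - 1) - 1 < 0 → (a * b - b * a) ^ N = 0) ∧
        ∀ m : ℕ, (m : ℤ) = (N : ℤ) * ((i : ℤ) + (j : ℤ) - 1) - 1 →
          (a * b - b * a) ^ N ∈ F m) := by
  intro i j a ha b hb
  have hG := isCommFiltration_extendByZero hone hmono hmul hbr hbr0
  have ha' : a ∈ (extendByZero F i).toAddSubgroup := ha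
  have hb' : b ∈ (extendByZero F j).toAddSubgroup := hb
  obtain ⟨f, hf, hA⟩ := exists_isPolyId_ne_zero hpi
  obtain ⟨r, M, hr, hmem⟩ := exists_zsmul_comm_pow_mem hf hA hG ha' hb'
  have hM : (a * b - b * a) ^ M ∈ extendByZero F (M * j + M * i - M - 1) := by
    have hmem' : r • (a * b - b * a) ^ M ∈ extendByZero F (M * j + M * i - M - 1) := hmem
    rw [← Int.cast_smul_eq_zsmul ℂ] at hmem'
    exact (Submodule.smul_mem_iff _ (Int.cast_ne_zero.2 hr)).1 hmem'
  have hN : (a * b - b * a) ^ (M + 1) ∈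
      extendByZero F (((M + 1 : ℕ) : ℤ) * ((i : ℤ) + (j : ℤ) - 1) - 1) := by
    have h := hG.mul_mem hM (hG.comm_mem ha' hb')
    rw [← pow_succ, show (M * j + M * i - M - 1 : ℤ) + (i + j - 1) =
      ((M + 1 : ℕ) : ℤ) * ((i : ℤ) + (j : ℤ) - 1) - 1 by push_cast; ring] at h
    exact h
  refine ⟨M + 1, by omega, fun hneg => ?_, fun m hm => ?_⟩
  · exact eq_zero_of_mem_extendByZero hneg hN
  · rw [← hm] at hN
    exact hN
end

section
/- For every n ≥ 1 and all matrices A, B ∈ M_n(ℂ), one has p_n(A, B; B^n) = 0. -/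
/-- The iterated commutator expressions `p_i(X, Y; Z)` of the paper:
`p₁(X,Y;Z) = [Z,X] = ZX - XZ` and
`p_i(X,Y;Z) = [p_{i-1}(X,Y;Z), p_{i-1}(X,Y;Y^{i-1})]` for `i ≥ 2`. -/
def pComm {R : Type*} [Ring R] (X Y : R) : ℕ → R → R
  | 0, Z => Z
  | 1, Z => Z * X - X * Z
  | (i + 2), Z =>
      pComm X Y (i + 1) Z * pComm X Y (i + 1) (Y ^ (i + 1)) -
        pComm X Y (i + 1) (Y ^ (i + 1)) * pComm X Y (i + 1) Z

/-- `p_i(X, Y; Z)` is linear in `Z`. -/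
theorem exists_linearMap_eq_pComm (K : Type*) {R : Type*} [CommRing K] [Ring R] [Algebra K R]
    (X Y : R) : ∀ i : ℕ, ∃ f : R →ₗ[K] R, ∀ Z, f Z = pComm X Y i Z
  | 0 => ⟨LinearMap.id, fun _ => rfl⟩
  | 1 => ⟨LinearMap.mulRight K X - LinearMap.mulLeft K X, fun _ => rfl⟩
  | i + 2 => by
    obtain ⟨f, hf⟩ := exists_linearMap_eq_pComm K X Y (i + 1)
    let W := pComm X Y (i + 1) (Y ^ (i + 1))
    exact ⟨(LinearMap.mulRight K W - LinearMap.mulLeft K W) ∘ₗ f, fun Z => by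
      simp [pComm, hf, W]⟩

/-- `p_i(X, Y; Y ^ k)` vanishes for every `k < i`. -/
theorem pComm_pow_eq_zero {R : Type*} [Ring R] (X Y : R) :
    ∀ {i k : ℕ}, k < i → pComm X Y i (Y ^ k) = 0
  | 1, k, h => by
    obtain rfl : k = 0 := by omega
    simp [pComm]
  | i + 2, k, h => by
    rcases Nat.lt_succ_iff_lt_or_eq.mp h with h | rfl
    · simp [pComm, pComm_pow_eq_zero X Y h]
    · simp [pComm]

/-- For every `n ≥ 1` and all matrices `A, B ∈ M_n(ℂ)`, one has `p_n(A, B; B^n) = 0`. -/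
theorem stmt1 (n : ℕ) (hn : 1 ≤ n) (A B : Matrix (Fin n) (Fin n) ℂ) :
    pComm A B n (B ^ n) = 0 := by
  obtain ⟨f, hf⟩ := exists_linearMap_eq_pComm ℂ A B n
  have hdeg : B.charpoly.natDegree = n := by simp
  have hlead : B.charpoly.coeff n = 1 := by
    simpa [Polynomial.Monic, Polynomial.leadingCoeff, hdeg] using B.charpoly_monic
  have hCH := congrArg f B.aeval_self_charpoly
  rw [Polynomial.aeval_eq_sum_range, hdeg, Finset.sum_range_succ, hlead, one_smul, map_add,
    map_sum, map_zero, Finset.sum_eq_zero, zero_add, hf] at hCH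
  · exact hCH
  · intro k hk
    rw [map_smul, hf, pComm_pow_eq_zero A B (Finset.mem_range.mp hk), smul_zero]
end

section
/- Let A be a unital ℂ-algebra whose dimension as a ℂ-vector space is at most countable, and let V be a simple (left) A-module. Then every polynomial identity of A is a polynomial identity of M_d(ℂ) for every natural number d with d ≤ dim_ℂ V; in particular dim_ℂ V ≤ PI.deg(A). -/
open Polynomial

/-- Over an algebraically closed field, a nonzero polynomial in an element with empty spectrum
is invertible. -/
theorem isUnit_aeval_of_spectrum_eq_empty {K B : Type*} [Field K] [IsAlgClosed K] [Ring B]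
    [Algebra K B] {a : B} (ha : spectrum K a = ∅) {p : K[X]} (hp : p ≠ 0) :
    IsUnit (aeval a p) := by
  rw [(IsAlgClosed.splits p).eq_prod_roots, map_mul, aeval_C]
  refine ((IsUnit.mk0 _ (leadingCoeff_ne_zero.2 hp)).map _).mul ?_
  by_contra h
  obtain ⟨k, hk, -⟩ := spectrum.exists_mem_of_not_isUnit_aeval_prod h
  simp [ha] at hk

/-- If `a` has empty spectrum and `v ≠ 0`, the family of all `(a - c)⁻¹ v` is linearly
independent. -/
theorem linearIndependent_of_sub_smul_eq {K B V : Type*} [Field K] [IsAlgClosed K] [Ring B]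
    [Algebra K B] [AddCommGroup V] [Module K V] [Module B V] [IsScalarTower K B V]
    {a : B} (ha : spectrum K a = ∅) {v : V} (hv : v ≠ 0) {w : K → V}
    (hw : ∀ c, (a - algebraMap K B c) • w c = v) : LinearIndependent K w := by
  classical
  rw [linearIndependent_iff']
  intro s g hg c hc
  set p : K[X] := ∑ c ∈ s, C (g c) * ∏ b ∈ s.erase c, (X - C b) with hp
  have hpv : aeval a p • v = 0 := by
    calc aeval a p • v = aeval a (∏ b ∈ s, (X - C b)) • ∑ c ∈ s, g c • w c := by
          rw [hp, map_sum, Finset.sum_smul, Finset.smul_sum]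
          refine Finset.sum_congr rfl fun c hc ↦ ?_
          rw [← Finset.prod_erase_mul s _ hc, map_mul, map_mul, aeval_C, mul_smul, mul_smul,
            algebraMap_smul, smul_comm _ (g c), smul_comm _ (g c)]
          simp [hw]
      _ = 0 := by rw [hg, smul_zero]
  have hp0 : p = 0 := by
    by_contra h
    exact hv ((isUnit_aeval_of_spectrum_eq_empty ha h).smul_eq_zero.1 hpv)
  have heval : eval c p = g c * ∏ b ∈ s.erase c, (c - b) := by
    rw [hp, eval_finsetSum, Finset.sum_eq_single_of_mem c hc]
    · simp [eval_prod]
    · intro d _ hdc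
      rw [eval_mul, eval_prod, Finset.prod_eq_zero (Finset.mem_erase.2 ⟨hdc.symm, hc⟩), mul_zero]
      simp
  rw [hp0, eval_zero, eq_comm, mul_eq_zero] at heval
  refine heval.resolve_right (Finset.prod_ne_zero_iff.2 fun b hb ↦ ?_)
  exact sub_ne_zero.2 (Finset.ne_of_mem_erase hb).symm

/-- A simple module over an algebra of countable dimension has countable dimension. -/
theorem rank_le_aleph0_of_isSimpleModule (K : Type*) {A V : Type*} [Field K] [Ring A] [Algebra K A]
    (hA : Module.rank K A ≤ Cardinal.aleph0) [AddCommGroup V] [Module K V] [Module A V]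
    [IsScalarTower K A V] [IsSimpleModule A V] : Module.rank K V ≤ Cardinal.aleph0 := by
  have := IsSimpleModule.nontrivial A V
  obtain ⟨v, hv⟩ := exists_ne (0 : V)
  let q : A →ₗ[K] V := (LinearMap.toSpanSingleton A V v).restrictScalars K
  have hq : Function.Surjective q := IsSimpleModule.toSpanSingleton_surjective A hv
  have h := lift_rank_range_le q
  rw [LinearMap.range_eq_top.2 hq, rank_top] at h
  rw [← Cardinal.lift_le_aleph0]
  exact h.trans (Cardinal.lift_le_aleph0.2 hA)

/-- **Dixmier's form of Schur's lemma**: over an uncountable algebraically closed field, every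
endomorphism of a simple module over an algebra of countable dimension is a scalar. -/
theorem exists_forall_apply_eq_smul {K A V : Type*} [Field K] [IsAlgClosed K]
    (hK : Cardinal.aleph0 < Cardinal.mk K) [Ring A] [Algebra K A]
    (hA : Module.rank K A ≤ Cardinal.aleph0) [AddCommGroup V] [Module K V] [Module A V]
    [IsScalarTower K A V] [IsSimpleModule A V] (T : Module.End A V) :
    ∃ c : K, ∀ v, T v = c • v := by
  classical
  have : SMulCommClass A K V := IsScalarTower.to_smulCommClass'
  have := IsSimpleModule.nontrivial A V
  obtain ⟨v, hv⟩ := exists_ne (0 : V)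
  by_contra! hT
  have hunit (c : K) : IsUnit (T - algebraMap K (Module.End A V) c) := by
    refine IsUnit.mk0 _ fun h ↦ ?_
    obtain ⟨x, hx⟩ := hT c
    exact hx (by simpa [sub_eq_zero] using LinearMap.congr_fun h x)
  have hempty : spectrum K T = ∅ := by
    refine Set.eq_empty_of_forall_notMem fun c hc ↦ hc ?_
    rw [spectrum.mem_resolventSet_iff, ← neg_sub]
    exact (hunit c).neg
  have hli : LinearIndependent K fun c ↦ (((hunit c).unit⁻¹ : (Module.End A V)ˣ) :
      Module.End A V) • v :=
    linearIndependent_of_sub_smul_eq hempty hv fun c ↦ by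
      rw [smul_smul, IsUnit.mul_val_inv, one_smul]
  have h := hli.cardinal_lift_le_rank.trans
    (Cardinal.lift_le_aleph0.2 (rank_le_aleph0_of_isSimpleModule K hA))
  exact absurd (Cardinal.lift_le_aleph0.1 h) hK.not_ge

/-- Elements of an algebra of countable dimension realise every linear endomorphism of a simple
module on any finite set of vectors. -/
theorem exists_forall_mem_smul_eq {K A V : Type*} [Field K] [IsAlgClosed K]
    (hK : Cardinal.aleph0 < Cardinal.mk K) [Ring A] [Algebra K A]
    (hA : Module.rank K A ≤ Cardinal.aleph0) [AddCommGroup V] [Module K V] [Module A V]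
    [IsScalarTower K A V] [IsSimpleModule A V] (g : V →ₗ[K] V) (s : Finset V) :
    ∃ a : A, ∀ v ∈ s, a • v = g v := by
  let g' : Module.End (Module.End A V) V :=
    { g with
      map_smul' := fun T v ↦ by
        obtain ⟨c, hc⟩ := exists_forall_apply_eq_smul hK hA T
        simp [hc] }
  obtain ⟨a, ha⟩ := jacobson_density (R := A) g' s
  exact ⟨a, fun v hv ↦ (ha v hv).symm⟩

/-- An intertwiner of two substitutions of the generators intertwines all their evaluations. -/
theorem freeAlgebra_lift_smul_eq {X A B V W : Type*} [Ring A] [Ring B] [AddCommGroup V]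
    [AddCommGroup W] [Module A V] [Module B W] (L : W →+ V) (φ : X → A) (ψ : X → B)
    (h : ∀ n x, φ n • L x = L (ψ n • x)) (f : FreeAlgebra ℤ X) (x : W) :
    FreeAlgebra.lift ℤ φ f • L x = L (FreeAlgebra.lift ℤ ψ f • x) := by
  induction f using FreeAlgebra.induction generalizing x with
  | grade0 r => simp [Int.cast_smul_eq_zsmul]
  | grade1 n => simp [h]
  | mul a b iha ihb => simp [mul_smul, iha, ihb]
  | add a b iha ihb => simp [add_smul, iha, ihb]

theorem IsPolyId.of_injective {B C : Type*} [Ring B] [Ring C] {e : B →+* C}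
    (he : Function.Injective e) {f : FreeAlgebra ℤ ℕ} (hf : IsPolyId C f) : IsPolyId B f := by
  intro φ
  apply he
  have h : e.toIntAlgHom.comp (FreeAlgebra.lift ℤ φ) = FreeAlgebra.lift ℤ (e ∘ φ) := by
    ext1
    funext n
    simp
  rw [map_zero, ← hf (e ∘ φ), ← h]
  rfl

/-- Identities of `A` are identities of matrix algebras of size at most the dimension of a simple
module. -/
theorem IsPolyId.matrix_of_le_rank {A : Type*} [Ring A] [Algebra ℂ A]
    (hA : Module.rank ℂ A ≤ Cardinal.aleph0)
    (V : Type*) [AddCommGroup V] [Module ℂ V] [Module A V] [IsScalarTower ℂ A V]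
    [IsSimpleModule A V] {d : ℕ} (hd : (d : Cardinal) ≤ Module.rank ℂ V)
    {f : FreeAlgebra ℤ ℕ} (hf : IsPolyId A f) : IsPolyId (Matrix (Fin d) (Fin d) ℂ) f := by
  classical
  refine IsPolyId.of_injective (C := Module.End ℂ (Fin d → ℂ))
    (e := (Matrix.toLinAlgEquiv' : Matrix (Fin d) (Fin d) ℂ ≃ₐ[ℂ] _).toRingEquiv.toRingHom)
    Matrix.toLinAlgEquiv'.injective fun ψ ↦ ?_
  obtain ⟨L, hL⟩ := Module.le_rank_iff_exists_linearMap.1 hd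
  obtain ⟨P, hP⟩ := L.exists_leftInverse_of_injective (LinearMap.ker_eq_bot.2 hL)
  have hPL (x) : P (L x) = x := LinearMap.congr_fun hP x
  have hK : Cardinal.aleph0 < Cardinal.mk ℂ := by
    rw [Cardinal.mk_complex]
    exact Cardinal.aleph0_lt_continuum
  have key (n : ℕ) : ∃ a : A, ∀ x, a • L x = L (ψ n x) := by
    have : SMulCommClass A ℂ V := IsScalarTower.to_smulCommClass'
    obtain ⟨a, ha⟩ := exists_forall_mem_smul_eq hK hA (L ∘ₗ ψ n ∘ₗ P)
      (Finset.univ.image fun i ↦ L (Pi.single i 1))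
    have hext : Module.toModuleEnd ℂ (S := A) V a ∘ₗ L = L ∘ₗ ψ n := by
      refine LinearMap.pi_ext' fun i ↦ LinearMap.ext_ring ?_
      simpa [hPL] using ha _ (Finset.mem_image_of_mem _ (Finset.mem_univ i))
    exact ⟨a, LinearMap.congr_fun hext⟩
  choose φ hφ using key
  refine LinearMap.ext fun x ↦ hL ?_
  have h := freeAlgebra_lift_smul_eq L.toAddMonoidHom φ ψ (fun n x ↦ by simpa using hφ n x) f x
  rw [hf φ, zero_smul] at h
  simpa using h.symm

/-- Let `A` be a unital `ℂ`-algebra of at most countable dimension and `V` a simple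
left `A`-module.  Then every polynomial identity of `A` is a polynomial identity of
`M_d(ℂ)` for every natural number `d ≤ dim_ℂ V`; in particular `dim_ℂ V ≤ PI.deg A`. -/
theorem stmt2 (A : Type*) [Ring A] [Algebra ℂ A]
    (hcount : Module.rank ℂ A ≤ Cardinal.aleph0)
    (V : Type*) [AddCommGroup V] [Module ℂ V] [Module A V] [IsScalarTower ℂ A V]
    [IsSimpleModule A V] :
    (∀ d : ℕ, (d : Cardinal) ≤ Module.rank ℂ V →
      ∀ f : FreeAlgebra ℤ ℕ, IsPolyId A f → IsPolyId (Matrix (Fin d) (Fin d) ℂ) f) ∧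
    (∀ d : ℕ, (d : Cardinal) ≤ Module.rank ℂ V → (d : ℕ∞) ≤ PIdeg A) := by
  have h (d : ℕ) (hd : (d : Cardinal) ≤ Module.rank ℂ V) (f : FreeAlgebra ℤ ℕ)
      (hf : IsPolyId A f) : IsPolyId (Matrix (Fin d) (Fin d) ℂ) f :=
    hf.matrix_of_le_rank hcount V hd
  refine ⟨h, fun d hd ↦ ?_⟩
  rcases Nat.eq_zero_or_pos d with rfl | hpos
  · simp
  · exact le_iSup₂_of_le (f := fun (m : ℕ) _ ↦ (m : ℕ∞)) d ⟨hpos, h d hd⟩ le_rfl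
end

section
/- Let A be a unital ℂ-algebra and I a two-sided ideal of A which is nilpotent, i.e. there exists r ≥ 1 such that every product of r elements of I is zero. Then PI.deg(A/I) = PI.deg(A). -/
theorem FreeAlgebra.map_lift {R X A B : Type*} [CommSemiring R] [Semiring A] [Algebra R A]
    [Semiring B] [Algebra R B] (g : A →ₐ[R] B) (φ : X → A) (f : FreeAlgebra R X) :
    g (FreeAlgebra.lift R φ f) = FreeAlgebra.lift R (g ∘ φ) f := by
  have h : g.comp (FreeAlgebra.lift R φ) = FreeAlgebra.lift R (g ∘ φ) := by
    ext x
    simp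
  exact DFunLike.congr_fun h f

/-- A polynomial identity passes to homomorphic images. -/
theorem IsPolyId.of_surjective {A B : Type*} [Ring A] [Ring B] {f : FreeAlgebra ℤ ℕ}
    (hf : IsPolyId A f) (g : A →+* B) (hg : Function.Surjective g) : IsPolyId B f := by
  intro φ
  choose s hs using fun n => hg (φ n)
  have h := FreeAlgebra.map_lift g.toIntAlgHom s f
  rw [hf s, map_zero] at h
  have hφ : g.toIntAlgHom ∘ s = φ := funext hs
  rw [← hφ, ← h]

/-- Over a domain, a matrix `a` such that every `a * y` is nilpotent of bounded index vanishes. -/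
theorem Matrix.eq_zero_of_forall_mul_pow_eq_zero {n R : Type*} [Fintype n] [DecidableEq n]
    [CommRing R] [IsDomain R] (a : Matrix n n R) (r : ℕ)
    (h : ∀ y : Matrix n n R, (a * y) ^ r = 0) : a = 0 := by
  ext i j
  by_contra hij
  have hpow : ∀ k : ℕ, (a * Matrix.single j i 1) ^ (k + 1)
      = a i j ^ k • (a * Matrix.single j i 1) := by
    intro k
    induction k with
    | zero => simp
    | succ k ih =>
      have hsq : a * Matrix.single j i 1 * (a * Matrix.single j i 1)
          = a i j • (a * Matrix.single j i 1) := by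
        rw [Matrix.mul_assoc, ← Matrix.mul_assoc (Matrix.single j i 1),
          Matrix.single_mul_mul_single, ← Matrix.mul_smul, Matrix.smul_single]
        simp
      rw [pow_succ, ih, smul_mul_assoc, hsq, smul_smul, ← pow_succ]
  have h0 := hpow r
  rw [pow_succ, h, zero_mul] at h0
  have hii : a i j ^ r * a i j = 0 := by simpa using (congrFun (congrFun h0 i) i).symm
  exact hij (eq_zero_of_pow_eq_zero ((pow_succ _ r).trans hii))

/-- For an identity `f` modulo a nilpotent ideal, `(f(X₁, X₂, …) * X₀) ^ r` is an identity. -/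
theorem IsPolyId.shift_mul_pow {A : Type*} [Ring A] {I : TwoSidedIdeal A} {r : ℕ}
    (hI : ∀ x : Fin r → A, (∀ k, x k ∈ I) → (List.ofFn x).prod = 0)
    {f : FreeAlgebra ℤ ℕ} (hf : IsPolyId I.ringCon.Quotient f) :
    IsPolyId A ((FreeAlgebra.lift ℤ (fun n => FreeAlgebra.ι ℤ (n + 1)) f *
      FreeAlgebra.ι ℤ 0) ^ r) := by
  intro φ
  rw [map_pow, map_mul, FreeAlgebra.map_lift]
  have hmem : ∀ ψ : ℕ → A, FreeAlgebra.lift ℤ ψ f ∈ I := by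
    intro ψ
    have h := FreeAlgebra.map_lift (I.ringCon.mk').toIntAlgHom ψ f
    rw [hf] at h
    rw [TwoSidedIdeal.mem_iff]
    exact I.ringCon.eq.mp (h.trans (map_zero I.ringCon.mk').symm)
  have h := hI (fun _ => _) (fun _ => I.mul_mem_right _ (FreeAlgebra.lift ℤ φ (FreeAlgebra.ι ℤ 0))
    (hmem (FreeAlgebra.lift ℤ φ ∘ fun n => FreeAlgebra.ι ℤ (n + 1))))
  simpa only [List.ofFn_const, List.prod_replicate] using h

/-- If `B` has no nonzero `b` with all `b * y` nilpotent of index `r`, then `f` is an identity of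
`B` as soon as `(f(X₁, X₂, …) * X₀) ^ r` is. -/
theorem IsPolyId.of_shift_mul_pow {B : Type*} [Ring B] {r : ℕ}
    (hB : ∀ b : B, (∀ y, (b * y) ^ r = 0) → b = 0) {f : FreeAlgebra ℤ ℕ}
    (hf : IsPolyId B ((FreeAlgebra.lift ℤ (fun n => FreeAlgebra.ι ℤ (n + 1)) f *
      FreeAlgebra.ι ℤ 0) ^ r)) : IsPolyId B f := by
  intro φ
  refine hB _ fun y => ?_
  let ψ : ℕ → B := fun k => Nat.casesOn k y φ
  have h := hf ψ
  have hψ : FreeAlgebra.lift ℤ ψ ∘ (fun k => FreeAlgebra.ι ℤ (k + 1)) = φ :=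
    funext fun k => FreeAlgebra.lift_ι_apply ψ (k + 1)
  rwa [map_pow, map_mul, FreeAlgebra.map_lift, FreeAlgebra.lift_ι_apply, hψ] at h

/-- If `I` is a nilpotent two-sided ideal of a unital `ℂ`-algebra `A` (some product of
`r` elements of `I` is always zero, `r ≥ 1`), then `PI.deg(A/I) = PI.deg(A)`. -/
theorem stmt4 (A : Type*) [Ring A] [Algebra ℂ A] (I : TwoSidedIdeal A)
    (hnil : ∃ r : ℕ, 1 ≤ r ∧
      ∀ x : Fin r → A, (∀ k, x k ∈ I) → (List.ofFn x).prod = 0) :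
    PIdeg I.ringCon.Quotient = PIdeg A := by
  obtain ⟨r, -, hr⟩ := hnil
  have hset : ∀ m : ℕ,
      (∀ f : FreeAlgebra ℤ ℕ, IsPolyId I.ringCon.Quotient f →
        IsPolyId (Matrix (Fin m) (Fin m) ℂ) f) ↔
      ∀ f : FreeAlgebra ℤ ℕ, IsPolyId A f → IsPolyId (Matrix (Fin m) (Fin m) ℂ) f :=
    fun m => ⟨fun h f hf => h f (hf.of_surjective I.ringCon.mk' I.ringCon.mk'_surjective),
      fun h _ hf => (h _ (hf.shift_mul_pow hr)).of_shift_mul_pow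
        fun a => a.eq_zero_of_forall_mul_pow_eq_zero r⟩
  simp only [PIdeg, hset]
end

section
/- Let A be a unital ℂ-algebra, I a two-sided ideal of A, and J₁, J₂, …, J_m two-sided ideals of A each containing I such that J₁J₂⋯J_m ⊆ I (every product x₁x₂⋯x_m with x_k ∈ J_k lies in I). Then PI.deg(A/I) = max_{1 ≤ i ≤ m} PI.deg(A/J_i). -/
/-- Evaluation of noncommutative polynomials commutes with ring homomorphisms. -/
theorem FreeAlgebra.map_lift_int {A B : Type*} [Ring A] [Ring B] (g : A →+* B) (φ : ℕ → A)
    (f : FreeAlgebra ℤ ℕ) :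
    g (FreeAlgebra.lift ℤ φ f) = FreeAlgebra.lift ℤ (fun i => g (φ i)) f := by
  have h : g.toIntAlgHom.comp (FreeAlgebra.lift ℤ φ) = FreeAlgebra.lift ℤ (fun i => g (φ i)) := by
    ext i
    simp
  exact DFunLike.congr_fun h f

/-- Evaluating a polynomial after the renaming `s` of its variables. -/
theorem FreeAlgebra.lift_rename {B : Type*} [Ring B] (s : ℕ → ℕ) (φ : ℕ → B)
    (g : FreeAlgebra ℤ ℕ) :
    FreeAlgebra.lift ℤ φ (FreeAlgebra.lift ℤ (fun i => FreeAlgebra.ι ℤ (s i)) g) =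
      FreeAlgebra.lift ℤ (fun i => φ (s i)) g := by
  have h : (FreeAlgebra.lift ℤ φ).comp (FreeAlgebra.lift ℤ (fun i => FreeAlgebra.ι ℤ (s i))) =
      FreeAlgebra.lift ℤ (fun i => φ (s i)) := by
    ext i
    simp
  exact DFunLike.congr_fun h g

theorem isPolyId_quotient_iff {A : Type*} [Ring A] (J : TwoSidedIdeal A) (f : FreeAlgebra ℤ ℕ) :
    IsPolyId J.ringCon.Quotient f ↔ ∀ φ : ℕ → A, FreeAlgebra.lift ℤ φ f ∈ J := by
  have key (φ : ℕ → A) : FreeAlgebra.lift ℤ φ f ∈ J ↔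
      J.ringCon.mk' (FreeAlgebra.lift ℤ φ f) = 0 := by
    rw [TwoSidedIdeal.mem_iff, ← map_zero J.ringCon.mk']
    exact (RingCon.eq _).symm
  refine ⟨fun h φ => (key φ).2 ((FreeAlgebra.map_lift_int _ φ f).trans (h _)), fun h φ => ?_⟩
  choose ψ hψ using fun i => RingCon.mk'_surjective (c := J.ringCon) (φ i)
  rw [← funext hψ]
  exact (FreeAlgebra.map_lift_int _ ψ f).symm.trans ((key ψ).1 (h ψ))

/-- Matrix algebras over a field are prime rings. -/
theorem Matrix.exists_mul_mul_ne_zero {n K : Type*} [Fintype n] [DecidableEq n] [Field K]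
    {a b : Matrix n n K} (ha : a ≠ 0) (hb : b ≠ 0) : ∃ c, a * c * b ≠ 0 := by
  obtain ⟨i, j, hij⟩ : ∃ i j, a i j ≠ 0 := by
    by_contra! h
    exact ha (Matrix.ext h)
  obtain ⟨k, l, hkl⟩ : ∃ k l, b k l ≠ 0 := by
    by_contra! h
    exact hb (Matrix.ext h)
  refine ⟨Matrix.single j k 1, fun h => mul_ne_zero hij hkl ?_⟩
  simpa [Matrix.mul_apply, Matrix.single_apply, ite_and] using congrFun (congrFun h i) l

/-- If no `f k` is an identity of the prime ring `R`, then neither is a suitable product of the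
`f k` in disjoint variables, separated by new variables. Its values on `A` are products of elements
of the ideals containing the values of the `f k`. -/
theorem exists_not_isPolyId_of_forall {R A : Type*} [Ring R] [Nontrivial R] [Ring A]
    (hR : ∀ a b : R, a ≠ 0 → b ≠ 0 → ∃ c, a * c * b ≠ 0) (m : ℕ)
    (J : Fin m → TwoSidedIdeal A) (f : Fin m → FreeAlgebra ℤ ℕ)
    (hfR : ∀ k, ¬ IsPolyId R (f k))
    (hfA : ∀ k (φ : ℕ → A), FreeAlgebra.lift ℤ φ (f k) ∈ J k) :
    ∃ h : FreeAlgebra ℤ ℕ, ¬ IsPolyId R h ∧ ∀ φ : ℕ → A, ∃ x : Fin m → A,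
      (∀ k, x k ∈ J k) ∧ FreeAlgebra.lift ℤ φ h = (List.ofFn x).prod := by
  induction m with
  | zero => exact ⟨1, by simp [IsPolyId], fun φ => ⟨Fin.elim0, fun k => k.elim0, by simp⟩⟩
  | succ m ih =>
    obtain ⟨h, hhR, hhA⟩ := ih (fun k => J k.succ) (fun k => f k.succ) (fun k => hfR _)
      (fun k => hfA _)
    refine ⟨FreeAlgebra.lift ℤ (fun i => FreeAlgebra.ι ℤ (2 * i + 1)) (f 0) * FreeAlgebra.ι ℤ 0 *
      FreeAlgebra.lift ℤ (fun i => FreeAlgebra.ι ℤ (2 * i + 2)) h, ?_, fun φ => ?_⟩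
    · have h0 := hfR 0
      simp only [IsPolyId, not_forall] at h0 hhR ⊢
      obtain ⟨α, hα⟩ := h0
      obtain ⟨β, hβ⟩ := hhR
      obtain ⟨c, hc⟩ := hR _ _ hα hβ
      refine ⟨fun | 0 => c | i + 1 => if i % 2 = 0 then α (i / 2) else β (i / 2), ?_⟩
      have hodd (i : ℕ) : (2 * i + 1) / 2 = i := by omega
      simpa [FreeAlgebra.lift_rename, hodd] using hc
    · obtain ⟨x, hx, hxh⟩ := hhA (fun i => φ (2 * i + 2))
      refine ⟨Fin.cons (FreeAlgebra.lift ℤ (fun i => φ (2 * i + 1)) (f 0) * φ 0) x, ?_, ?_⟩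
      · exact Fin.cases ((J 0).mul_mem_right _ _ (hfA 0 _)) hx
      · simp [FreeAlgebra.lift_rename, hxh, List.ofFn_succ]

theorem PIdeg_le_of_forall_isPolyId {A B : Type*} [Ring A] [Ring B]
    (h : ∀ f, IsPolyId A f → IsPolyId B f) : PIdeg B ≤ PIdeg A :=
  iSup₂_le fun n hn => le_iSup₂ (f := fun (n : ℕ) _ => (n : ℕ∞)) n
    ⟨hn.1, fun f hf => hn.2 f (h f hf)⟩

/-- Let `I, J₁, …, J_m` be two-sided ideals of a unital `ℂ`-algebra `A` with `I ⊆ J_k`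
for every `k` and `J₁J₂⋯J_m ⊆ I`.  Then `PI.deg(A/I) = max_k PI.deg(A/J_k)`. -/
theorem stmt5 (A : Type*) [Ring A] [Algebra ℂ A] (I : TwoSidedIdeal A)
    (m : ℕ) (hm : 1 ≤ m) (J : Fin m → TwoSidedIdeal A)
    (hIJ : ∀ k, I ≤ J k)
    (hprod : ∀ x : Fin m → A, (∀ k, x k ∈ J k) → (List.ofFn x).prod ∈ I) :
    PIdeg I.ringCon.Quotient = ⨆ k : Fin m, PIdeg (J k).ringCon.Quotient := by
  refine le_antisymm (iSup₂_le ?_) (iSup_le fun k => PIdeg_le_of_forall_isPolyId fun f hf => ?_)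
  · rintro n ⟨hn, hI⟩
    by_cases hk : ∃ k, ∀ f : FreeAlgebra ℤ ℕ, IsPolyId (J k).ringCon.Quotient f →
        IsPolyId (Matrix (Fin n) (Fin n) ℂ) f
    · obtain ⟨k, hk⟩ := hk
      exact le_iSup_of_le k (le_iSup₂ (f := fun (n : ℕ) _ => (n : ℕ∞)) n ⟨hn, hk⟩)
    · push Not at hk
      choose f hfA hfR using hk
      have : Nonempty (Fin n) := ⟨⟨0, hn⟩⟩
      obtain ⟨h, hhR, hhA⟩ := exists_not_isPolyId_of_forall
        (fun _ _ => Matrix.exists_mul_mul_ne_zero) m J f hfR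
        (fun k => (isPolyId_quotient_iff _ _).1 (hfA k))
      refine absurd (hI h ((isPolyId_quotient_iff _ _).2 fun φ => ?_)) hhR
      obtain ⟨x, hx, hxh⟩ := hhA φ
      exact hxh ▸ hprod x hx
  · rw [isPolyId_quotient_iff] at hf ⊢
    exact fun φ => hIJ k (hf φ)
end

section
/- Let A be a unital ℂ-algebra of at most countable dimension over ℂ which is either semiprimitive (J(A) = 0) or left noetherian. Then PI.deg(A) equals the supremum, taken in ℕ ∪ {∞}, of dim_ℂ V over all simple (left) A-modules V (with infinite-dimensional simple modules contributing ∞). -/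
universe u

section Spectral

open Polynomial

variable {B : Type*} [Ring B] [Algebra ℂ B]

theorem isAlgebraic_of_countable_spectrum (hB : Module.rank ℂ B ≤ Cardinal.aleph0) {a : B}
    (ha : (spectrum ℂ a).Countable) : IsAlgebraic ℂ a := by
  have hdep : ¬ LinearIndependent ℂ (fun r : resolventSet ℂ a => resolvent a (r : ℂ)) := by
    intro hli
    have hcard := hli.cardinal_lift_le_rank.trans (Cardinal.lift_le.2 hB)
    have hres : (resolventSet ℂ a).Countable := by
      rw [← Cardinal.le_aleph0_iff_set_countable]
      simpa using hcard
    refine not_countable_complex ?_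
    rw [← Set.compl_union_self (resolventSet ℂ a)]
    exact ha.union hres
  obtain ⟨s, g, hsum, j, hjs, hj⟩ := not_linearIndependent_iff.mp hdep
  classical
  let q : ℂ[X] := ∑ i ∈ s, C (g i) * ∏ k ∈ s.erase i, (C (k : ℂ) - X)
  refine ⟨q, ?_, ?_⟩
  · intro hq
    have heval : q.eval (j : ℂ) = g j * ∏ k ∈ s.erase j, ((k : ℂ) - j) := by
      simp only [q, eval_finsetSum, eval_mul, eval_C, eval_prod, eval_sub, eval_X]
      refine Finset.sum_eq_single_of_mem j hjs fun i _ hij => ?_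
      rw [Finset.prod_eq_zero (Finset.mem_erase.2 ⟨Ne.symm hij, hjs⟩) (sub_self _), mul_zero]
    rw [hq, eval_zero, eq_comm, mul_eq_zero, Finset.prod_eq_zero_iff] at heval
    obtain h | ⟨k, hk, hkj⟩ := heval
    · exact hj h
    · exact (Finset.mem_erase.1 hk).1 (Subtype.ext (sub_eq_zero.1 hkj))
  · have key : aeval a q =
        aeval a (∏ k ∈ s, (C (k : ℂ) - X)) * ∑ i ∈ s, g i • resolvent a (i : ℂ) := by
      simp only [q, map_sum, map_mul, aeval_C, Finset.mul_sum, mul_smul_comm,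
        ← Algebra.smul_def]
      refine Finset.sum_congr rfl fun i hi => ?_
      rw [← Finset.prod_erase_mul s _ hi, map_mul, mul_assoc]
      have hunit : IsUnit (algebraMap ℂ B i - a) := i.2
      have : aeval a (C (i : ℂ) - X) * resolvent a (i : ℂ) = 1 := by
        simp only [map_sub, aeval_C, aeval_X]
        exact Ring.mul_inverse_cancel _ hunit
      rw [this, mul_one]
    rw [key, hsum, mul_zero]

theorem spectrum_nonempty_of_rank_le_aleph0 [Nontrivial B]
    (hB : Module.rank ℂ B ≤ Cardinal.aleph0) (a : B) : (spectrum ℂ a).Nonempty := by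
  by_contra! hempty
  obtain ⟨p, hp, hpa⟩ := isAlgebraic_of_countable_spectrum hB (a := a) (by simp [hempty])
  have hsplit := (IsAlgClosed.splits p).eq_prod_roots
  have hnot : ¬ IsUnit (aeval a (p.roots.map fun r => X - C r).prod) := by
    intro hu
    rw [hsplit, map_mul, aeval_C] at hpa
    have := hu.mul_left_eq_zero.1 hpa
    exact hp (leadingCoeff_eq_zero.1 ((map_eq_zero _).1 this))
  obtain ⟨k, hk, -⟩ := spectrum.exists_mem_of_not_isUnit_aeval_prod hnot
  simp [hempty] at hk

theorem isNilpotent_of_spectrum_subset_zero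
    (hB : Module.rank ℂ B ≤ Cardinal.aleph0) {a : B} (ha : spectrum ℂ a ⊆ {0}) :
    IsNilpotent a := by
  obtain ⟨p, hp, hpa⟩ := isAlgebraic_of_countable_spectrum hB
    ((Set.countable_singleton 0).mono ha)
  obtain ⟨q, hpq, hq⟩ := p.exists_eq_pow_rootMultiplicity_mul_and_not_dvd hp 0
  rw [C_0, sub_zero] at hpq hq
  have hq0 : q ≠ 0 := by rintro rfl; simp at hq
  have hu : IsUnit (aeval a q) := by
    rw [(IsAlgClosed.splits q).eq_prod_roots, map_mul, aeval_C]
    refine IsUnit.mul ((isUnit_iff_ne_zero.2 (leadingCoeff_ne_zero.2 hq0)).map _) ?_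
    by_contra hnot
    obtain ⟨k, hk, hkq⟩ := spectrum.exists_mem_of_not_isUnit_aeval_prod hnot
    obtain rfl : k = 0 := by simpa using ha hk
    apply hq
    rw [X_dvd_iff, coeff_zero_eq_eval_zero, hkq]
  refine ⟨p.rootMultiplicity 0, ?_⟩
  rw [hpq, map_mul, map_pow, aeval_X] at hpa
  exact hu.mul_left_eq_zero.1 hpa

end Spectral

section Jacobson

theorem isUnit_one_add_of_mem_jacobson {R : Type*} [Ring R] {a : R} (ha : a ∈ Ring.jacobson R) :
    IsUnit (1 + a) := by
  have hleft : ∀ b ∈ Ring.jacobson R, ∃ c, c * (1 + b) = 1 := by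
    intro b hb
    rw [← Ideal.jacobson_bot] at hb
    obtain ⟨c, hc⟩ := Ideal.mem_jacobson_iff.1 hb 1
    refine ⟨c, sub_eq_zero.1 ?_⟩
    rw [← Ideal.mem_bot (R := R)]
    convert hc using 1
    noncomm_ring
  obtain ⟨c, hc⟩ := hleft a ha
  have hca : c = 1 + -(c * a) := by rw [← hc]; noncomm_ring
  obtain ⟨e, he⟩ := hleft _ (neg_mem ((Ring.jacobson R).mul_mem_left c ha))
  rw [← hca] at he
  obtain rfl : e = 1 + a := by
    calc e = e * (c * (1 + a)) := by rw [hc, mul_one]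
      _ = 1 + a := by rw [← mul_assoc, he, one_mul]
  exact ⟨⟨1 + a, c, he, hc⟩, rfl⟩

theorem isNilpotent_of_mem_jacobson {B : Type*} [Ring B] [Algebra ℂ B]
    (hB : Module.rank ℂ B ≤ Cardinal.aleph0) {a : B} (ha : a ∈ Ring.jacobson B) :
    IsNilpotent a := by
  refine isNilpotent_of_spectrum_subset_zero hB fun r hr => ?_
  by_contra hr0
  refine hr ?_
  have hr0 : r ≠ 0 := hr0
  have hmem : algebraMap ℂ B (-r⁻¹) * a ∈ Ring.jacobson B := Ideal.mul_mem_left _ _ ha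
  have hu := ((isUnit_iff_ne_zero.2 hr0).map (algebraMap ℂ B)).mul
    (isUnit_one_add_of_mem_jacobson hmem)
  change IsUnit (algebraMap ℂ B r - a)
  convert hu using 1
  rw [mul_add, mul_one, ← mul_assoc, ← map_mul, mul_neg, mul_inv_cancel₀ hr0]
  simp [sub_eq_add_neg]

theorem mem_jacobson_of_forall_simple {R : Type u} [Ring R] {a : R}
    (ha : ∀ (V : Type u) [AddCommGroup V] [Module R V], IsSimpleModule R V → ∀ v : V, a • v = 0) :
    a ∈ Ring.jacobson R := by
  rw [Ring.jacobson_eq_sInf_isMaximal, Submodule.mem_sInf]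
  intro I hI
  have h1 := ha (R ⧸ I) (isSimpleModule_iff_isCoatom.2 (Ideal.isMaximal_def.1 hI)) (Submodule.Quotient.mk 1)
  rwa [← Submodule.Quotient.mk_smul, smul_eq_mul, mul_one, Submodule.Quotient.mk_eq_zero] at h1

/-- **Levitzki's theorem**, in the form of a bound on the index of nilpotency. -/
theorem exists_forall_pow_eq_zero_of_nil {R : Type*} [Ring R] [IsNoetherianRing R]
    (J : Ideal R) [J.IsTwoSided] (hJ : ∀ a ∈ J, IsNilpotent a) :
    ∃ k : ℕ, ∀ a ∈ J, a ^ k = 0 := by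
  let S : Set (Ideal R) := {N | N.IsTwoSided ∧ ∃ k : ℕ, ∀ a ∈ N, a ^ k = 0}
  have hS : S.Nonempty := ⟨⊥, inferInstance, 1, by simp⟩
  obtain ⟨(N : Ideal R), ⟨hN, k, hk⟩, hmax⟩ := set_has_maximal_iff_noetherian.2 ‹IsNoetherianRing R› S hS
  suffices hle : J ≤ N from ⟨k, fun a ha => hk a (hle ha)⟩
  by_contra hle
  obtain ⟨a₀, ha₀J, ha₀N⟩ := SetLike.not_le_iff_exists.1 hle
  let ann : R → Ideal R := fun a => Submodule.comap (LinearMap.toSpanSingleton R R a) N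
  have mem_ann : ∀ {a x : R}, x ∈ ann a ↔ x * a ∈ N := fun {a x} => by
    simp [ann, Submodule.mem_comap]
  obtain ⟨_, ⟨a, ⟨haJ, haN⟩, rfl⟩, hamax⟩ :=
    set_has_maximal_iff_noetherian.2 ‹IsNoetherianRing R›
      (Set.image ann {a | a ∈ J ∧ a ∉ N}) ⟨_, a₀, ⟨ha₀J, ha₀N⟩, rfl⟩
  have haua : ∀ u, a * u * a ∈ N := by
    intro u
    by_cases hau : a * u ∈ N
    · exact N.mul_mem_right a hau
    have hex : ∃ l, (a * u) ^ l ∈ N := by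
      obtain ⟨l, hl⟩ := hJ _ (J.mul_mem_right u haJ)
      exact ⟨l, by simp [hl]⟩
    classical
    let l := Nat.find hex
    have hl : (a * u) ^ l ∈ N := Nat.find_spec hex
    obtain ⟨t, ht⟩ : ∃ t, l = t + 2 := by
      have h0 : l ≠ 0 := by
        intro h0
        rw [h0, pow_zero] at hl
        exact haN (by simpa using N.mul_mem_left a hl)
      have h1 : l ≠ 1 := by
        intro h1
        rw [h1, pow_one] at hl
        exact hau hl
      exact ⟨l - 2, by omega⟩
    have hb : (a * u) ^ (t + 1) ∉ N := Nat.find_min hex (show t + 1 < l by omega)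
    have hbJ : (a * u) ^ (t + 1) ∈ J := by
      rw [pow_succ]
      exact J.mul_mem_left _ (J.mul_mem_right u haJ)
    have hsub : ann a ≤ ann ((a * u) ^ (t + 1)) := by
      intro x hx
      rw [mem_ann] at hx ⊢
      rw [pow_succ', ← mul_assoc, ← mul_assoc]
      exact N.mul_mem_right _ (N.mul_mem_right _ hx)
    have hnot := hamax _ ⟨_, ⟨hbJ, hb⟩, rfl⟩
    have heq : ann a = ann ((a * u) ^ (t + 1)) := hsub.eq_of_not_lt hnot
    rw [← mem_ann, heq, mem_ann, ← pow_succ', ← ht]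
    exact hl
  let T : Set R := Set.range (fun v => a * v) ∪ N
  have hT : ∀ c ∈ Ideal.span T, ∀ v, a * v * c ∈ N := by
    intro c hc
    induction hc using Submodule.span_induction with
    | mem c hc =>
      intro v
      obtain ⟨w, rfl⟩ | hc := hc
      · rw [← mul_assoc]
        exact N.mul_mem_right _ (haua v)
      · exact N.mul_mem_left _ hc
    | zero => simp
    | add c d _ _ hc hd => intro v; rw [mul_add]; exact add_mem (hc v) (hd v)
    | smul r c _ hc => intro v; rw [smul_eq_mul, ← mul_assoc, mul_assoc a]; exact hc _
  have hTT : ∀ b ∈ Ideal.span T, ∀ c ∈ Ideal.span T, b * c ∈ N := by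
    intro b hb c hc
    induction hb using Submodule.span_induction with
    | mem b hb =>
      obtain ⟨w, rfl⟩ | hb := hb
      · exact hT c hc w
      · exact N.mul_mem_right _ hb
    | zero => simp
    | add b d _ _ hb hd => rw [add_mul]; exact add_mem hb hd
    | smul r b _ hb => rw [smul_eq_mul, mul_assoc]; exact N.mul_mem_left _ hb
  have htwo : (Ideal.span T).IsTwoSided := by
    refine ⟨fun {b} r hb => ?_⟩
    induction hb using Submodule.span_induction with
    | mem b hb =>
      refine Ideal.subset_span ?_
      obtain ⟨w, rfl⟩ | hb := hb
      · exact Or.inl ⟨w * r, by simp [mul_assoc]⟩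
      · exact Or.inr (N.mul_mem_right _ hb)
    | zero => simp
    | add b d _ _ hb hd => rw [add_mul]; exact add_mem hb hd
    | smul s b _ hb => rw [smul_eq_mul, mul_assoc]; exact Ideal.mul_mem_left _ _ hb
  refine hmax (Ideal.span T) ⟨htwo, 2 * k, fun b hb => ?_⟩ (lt_of_le_of_ne ?_ ?_)
  · rw [pow_mul, sq]
    exact hk _ (hTT b hb b hb)
  · exact fun x hx => Ideal.subset_span (Or.inr hx)
  · intro heq
    refine haN ?_
    rw [heq]
    exact Ideal.subset_span (Or.inl ⟨1, mul_one a⟩)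

end Jacobson

section AlternatingPolynomial

open Equiv

/-- The sum over `π ∈ Sₙ` of `sign π • (x ^ π 0 * y) * (x ^ π 1 * y) * ⋯ * (x ^ π (n - 1) * y)`. -/
def altPowers {R : Type*} [Ring R] (n : ℕ) (x y : R) : R :=
  ∑ π : Perm (Fin n), Perm.sign π • (List.ofFn fun i => x ^ (π i : ℕ) * y).prod

theorem map_altPowers {R S F : Type*} [Ring R] [Ring S] [FunLike F R S] [RingHomClass F R S]
    (g : F) (n : ℕ) (x y : R) : g (altPowers n x y) = altPowers n (g x) (g y) := by
  simp [altPowers, Units.smul_def, map_list_prod, List.map_ofFn, Function.comp_def]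

theorem altPowers_eq_zero_of_finrank_lt {V : Type*} [AddCommGroup V] [Module ℂ V]
    [FiniteDimensional ℂ V] {n : ℕ} (hn : Module.finrank ℂ V < n) (x y : Module.End ℂ V) :
    altPowers n x y = 0 := by
  have hdep : ¬ LinearIndependent ℂ (fun i : Fin n => x ^ (i : ℕ)) := by
    rw [Fintype.not_linearIndependent_iff]
    refine ⟨fun i => (LinearMap.charpoly x).coeff i, ?_, ⟨Module.finrank ℂ V, hn⟩, ?_⟩
    · rw [Fin.sum_univ_eq_sum_range (fun i => (LinearMap.charpoly x).coeff i • x ^ i),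
        ← Polynomial.aeval_eq_sum_range' (by rwa [LinearMap.charpoly_natDegree]),
        LinearMap.aeval_self_charpoly]
    · have h := (LinearMap.charpoly_monic x).coeff_natDegree
      rw [LinearMap.charpoly_natDegree] at h
      simp [h]
  let m : MultilinearMap ℂ (fun _ : Fin n => Module.End ℂ V) (Module.End ℂ V) :=
    (MultilinearMap.mkPiAlgebraFin ℂ n (Module.End ℂ V)).compLinearMap
      fun _ => LinearMap.mulRight ℂ y
  have h := (MultilinearMap.alternatization m).map_linearDependent _ hdep
  rw [MultilinearMap.alternatization_apply] at h
  simpa [m, altPowers] using h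

theorem prod_ofFn_diagonal_mul_permMatrix {ι K : Type*} [Fintype ι] [DecidableEq ι] [CommRing K]
    (σ : Perm ι) {n : ℕ} (u : Fin n → ι → K) :
    (List.ofFn fun i => Matrix.diagonal (u i) * σ.permMatrix K).prod =
      Matrix.diagonal (fun j => ∏ i, u i ((σ ^ (i : ℕ)) j)) * σ.permMatrix K ^ n := by
  have hcomm (w : ι → K) : σ.permMatrix K * Matrix.diagonal w =
      Matrix.diagonal (w ∘ σ) * σ.permMatrix K := by
    ext i j
    by_cases h : σ i = j <;>
      simp [Matrix.mul_diagonal, Matrix.diagonal_mul, Perm.permMatrix, PEquiv.toMatrix_apply, h]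
  induction n with
  | zero => simp
  | succ n ih =>
    rw [List.ofFn_succ, List.prod_cons, ih, mul_assoc, ← mul_assoc (σ.permMatrix K), hcomm,
      mul_assoc, ← pow_succ', ← mul_assoc, Matrix.diagonal_mul_diagonal]
    congr 2
    ext j
    simp [Fin.prod_univ_succ, pow_succ]

theorem altPowers_diagonal_permMatrix {ι K : Type*} [Fintype ι] [DecidableEq ι] [CommRing K]
    (σ : Perm ι) (n : ℕ) (w : ι → K) :
    altPowers n (Matrix.diagonal w) (σ.permMatrix K) =
      Matrix.diagonal (fun j =>
        (Matrix.vandermonde fun i : Fin n => w ((σ ^ (i : ℕ)) j)).det) * σ.permMatrix K ^ n := by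
  simp only [altPowers, Matrix.diagonal_pow, prod_ofFn_diagonal_mul_permMatrix,
    ← smul_mul_assoc, ← Finset.sum_mul]
  congr 1
  ext i j
  by_cases h : i = j
  · subst h
    rw [Matrix.diagonal_apply_eq, ← Matrix.det_transpose, Matrix.det_apply]
    simp [Matrix.sum_apply, Matrix.vandermonde_apply]
  · simp [Matrix.sum_apply, h]

theorem exists_isUnit_altPowers {m n : ℕ} (hnm : n ≤ m) :
    ∃ x y : Matrix (Fin m) (Fin m) ℂ, IsUnit (altPowers n x y) := by
  cases m with
  | zero => exact ⟨0, 0, isUnit_of_subsingleton _⟩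
  | succ m =>
  let σ : Perm (Fin (m + 1)) := Equiv.addRight 1
  have hσ (i : ℕ) (j : Fin (m + 1)) : ((σ ^ i) j : ℕ) = (j + i) % (m + 1) := by
    induction i generalizing j with
    | zero => simp [Nat.mod_eq_of_lt j.2]
    | succ i ih =>
      rw [pow_succ, Perm.mul_apply, ih]
      simp [σ, Fin.val_add, add_assoc, add_comm 1 i]
  refine ⟨Matrix.diagonal fun i => ((i : ℕ) : ℂ), σ.permMatrix ℂ, ?_⟩
  rw [altPowers_diagonal_permMatrix]
  refine IsUnit.mul ?_ (IsUnit.pow _ ((Group.isUnit σ⁻¹).map (Matrix.permMatrixHom)))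
  rw [Matrix.isUnit_diagonal, Pi.isUnit_iff]
  intro j
  rw [isUnit_iff_ne_zero, Matrix.det_vandermonde_ne_zero_iff]
  intro a b hab
  have hmod : j + a ≡ j + b [MOD m + 1] := by
    simpa only [hσ, Nat.cast_inj, Nat.ModEq] using hab
  exact Fin.ext ((Nat.ModEq.add_left_cancel' _ hmod).eq_of_lt_of_lt
    (a.2.trans_le hnm) (b.2.trans_le hnm))

end AlternatingPolynomial

section Density

variable {A : Type*} [Ring A] [Algebra ℂ A] {V : Type*} [AddCommGroup V] [Module ℂ V]
  [Module A V] [IsScalarTower ℂ A V] [IsSimpleModule A V]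

open Matrix

/-- Schur's lemma for simple modules over algebras of countable dimension. -/
theorem exists_end_eq_smul_of_rank_le_aleph0 (hA : Module.rank ℂ A ≤ Cardinal.aleph0)
    (θ : Module.End A V) : ∃ c : ℂ, ∀ v : V, θ v = c • v := by
  have := IsScalarTower.to_smulCommClass' (R := ℂ) (A := A) (M := V)
  have := IsSimpleModule.nontrivial A V
  obtain ⟨v, hv⟩ := exists_ne (0 : V)
  have hV : Module.rank ℂ V ≤ Cardinal.aleph0 := by
    have hle := LinearMap.lift_rank_le_of_surjective
      ((LinearMap.toSpanSingleton A V v).restrictScalars ℂ)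
      (IsSimpleModule.toSpanSingleton_surjective A hv)
    simpa using hle.trans (Cardinal.lift_le.2 hA)
  let ev : Module.End A V →ₗ[ℂ] V :=
    { toFun := fun f => f v
      map_add' := fun _ _ => rfl
      map_smul' := fun _ _ => rfl }
  have hev : Function.Injective ev := by
    rw [← LinearMap.ker_eq_bot, LinearMap.ker_eq_bot']
    intro f hf
    refine f.injective_or_eq_zero.resolve_left fun hinj => hv (hinj ?_)
    rw [map_zero]
    exact hf
  have hE : Module.rank ℂ (Module.End A V) ≤ Cardinal.aleph0 :=
    (LinearMap.rank_le_of_injective ev hev).trans hV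
  obtain ⟨c, hc⟩ := spectrum_nonempty_of_rank_le_aleph0 hE θ
  refine ⟨c, fun w => ?_⟩
  have hzero : algebraMap ℂ (Module.End A V) c - θ = 0 := by
    by_contra hne
    exact hc ((Module.End.isUnit_iff _).2 (LinearMap.bijective_of_ne_zero hne))
  have hw := LinearMap.congr_fun hzero w
  rw [LinearMap.sub_apply, LinearMap.zero_apply, sub_eq_zero] at hw
  exact hw.symm

theorem exists_smul_eq_of_rank_le_aleph0 (hA : Module.rank ℂ A ≤ Cardinal.aleph0)
    (f : Module.End ℂ V) (s : Finset V) : ∃ a : A, ∀ v ∈ s, f v = a • v := by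
  let g : Module.End (Module.End A V) V :=
    { toFun := f
      map_add' := map_add f
      map_smul' := fun θ v => by
        obtain ⟨c, hc⟩ := exists_end_eq_smul_of_rank_le_aleph0 hA θ
        simp [hc] }
  exact jacobson_density g s

theorem isPolyId_matrix_of_linearIndependent (hA : Module.rank ℂ A ≤ Cardinal.aleph0) {n : ℕ}
    {b : Fin n → V} (hb : LinearIndependent ℂ b) {f : FreeAlgebra ℤ ℕ} (hf : IsPolyId A f) :
    IsPolyId (Matrix (Fin n) (Fin n) ℂ) f := by
  have := IsScalarTower.to_smulCommClass' (R := ℂ) (A := A) (M := V)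
  intro φ
  let L : (Fin n → ℂ) →ₗ[ℂ] V := Fintype.linearCombination ℂ b
  have hL : Function.Injective L := hb.fintypeLinearCombination_injective
  obtain ⟨P, hP⟩ := L.exists_leftInverse_of_injective (LinearMap.ker_eq_bot.2 hL)
  have hex (i : ℕ) : ∃ a : A, ∀ w, a • L w = L (φ i *ᵥ w) := by
    classical
    obtain ⟨a, ha⟩ := exists_smul_eq_of_rank_le_aleph0 hA (L ∘ₗ (φ i).mulVecLin ∘ₗ P)
      (Finset.univ.image b)
    refine ⟨a, fun w => ?_⟩
    have hgL : (L ∘ₗ (φ i).mulVecLin ∘ₗ P) (L w) = L (φ i *ᵥ w) := by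
      simp [show P (L w) = w from LinearMap.congr_fun hP w]
    rw [← hgL, show L w = ∑ j, w j • b j from Fintype.linearCombination_apply ..,
      Finset.smul_sum, map_sum]
    refine Finset.sum_congr rfl fun j _ => ?_
    rw [map_smul, ha (b j) (Finset.mem_image_of_mem b (Finset.mem_univ j)), smul_comm]
  choose a ha using hex
  let : Algebra ℤ (Matrix (Fin n) (Fin n) ℂ) := Ring.toIntAlgebra _
  have key (g : FreeAlgebra ℤ ℕ) :
      ∀ w, FreeAlgebra.lift ℤ a g • L w = L (FreeAlgebra.lift ℤ φ g *ᵥ w) := by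
    induction g using FreeAlgebra.induction with
    | grade0 r =>
      intro w
      rw [AlgHom.commutes, AlgHom.commutes, eq_intCast, eq_intCast, Int.cast_smul_eq_zsmul,
        Matrix.intCast_mulVec, Int.cast_smul_eq_zsmul, map_zsmul]
    | grade1 i => intro w; simpa using ha i w
    | mul g h hg hh => intro w; rw [map_mul, map_mul, mul_smul, hh, hg, Matrix.mulVec_mulVec]
    | add g h hg hh => intro w; rw [map_add, map_add, add_smul, hg, hh, Matrix.add_mulVec, map_add]
  refine Matrix.mulVec_injective (funext fun w => hL ?_)
  rw [← key, hf a, zero_smul, Matrix.zero_mulVec, map_zero]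

end Density

section Main

/-- If every simple module has dimension at most `d`, then some power of `altPowers (d + 1)`
vanishes identically on `A`. -/
theorem exists_pow_altPowers_eq_zero {A : Type u} [Ring A] [Algebra ℂ A]
    (hcount : Module.rank ℂ A ≤ Cardinal.aleph0)
    (h : (∀ a : A, (∀ (V : Type u) [AddCommGroup V] [Module A V],
            IsSimpleModule A V → ∀ v : V, a • v = 0) → a = 0)
        ∨ IsNoetherianRing A) {d : ℕ}
    (hd : ∀ (V : Type u) [AddCommGroup V] [Module ℂ V] [Module A V] [IsScalarTower ℂ A V],
      IsSimpleModule A V → Cardinal.toENat (Module.rank ℂ V) ≤ d) :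
    ∃ k : ℕ, ∀ x y : A, altPowers (d + 1) x y ^ k = 0 := by
  have hkill (x y : A) (V : Type u) [AddCommGroup V] [Module A V] (hV : IsSimpleModule A V)
      (v : V) : altPowers (d + 1) x y • v = 0 := by
    let : Module ℂ V := Module.compHom V (algebraMap ℂ A)
    have : IsScalarTower ℂ A V := ⟨fun c a w => by
      rw [Algebra.smul_def, mul_smul]; rfl⟩
    have hrank := hd V hV
    have hfin : FiniteDimensional ℂ V := by
      refine Module.rank_lt_aleph0_iff.1 (Cardinal.toENat_lt_top.1 ?_)
      exact hrank.trans_lt (ENat.natCast_lt_top d)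
    rw [← Module.finrank_eq_rank, Cardinal.toENat_nat, Nat.cast_le] at hrank
    have hzero := altPowers_eq_zero_of_finrank_lt (Nat.lt_succ_of_le hrank)
      (Algebra.lsmul ℂ ℂ V x) (Algebra.lsmul ℂ ℂ V y)
    rw [← map_altPowers] at hzero
    exact LinearMap.congr_fun hzero v
  obtain h | h := h
  · exact ⟨1, fun x y => by rw [pow_one]; exact h _ (hkill x y)⟩
  · obtain ⟨k, hk⟩ := exists_forall_pow_eq_zero_of_nil (Ring.jacobson A)
      fun a ha => isNilpotent_of_mem_jacobson hcount ha
    exact ⟨k, fun x y => hk _ (mem_jacobson_of_forall_simple (hkill x y))⟩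

theorem le_of_pow_altPowers_eq_zero {A : Type*} [Ring A] {d k m : ℕ}
    (hA : ∀ x y : A, altPowers (d + 1) x y ^ k = 0) (hm : 1 ≤ m)
    (hid : ∀ f : FreeAlgebra ℤ ℕ, IsPolyId A f → IsPolyId (Matrix (Fin m) (Fin m) ℂ) f) :
    m ≤ d := by
  by_contra! hlt
  obtain ⟨x, y, hxy⟩ := exists_isUnit_altPowers (Nat.succ_le_of_lt hlt)
  have hf := hid (altPowers (d + 1) (FreeAlgebra.ι ℤ 0) (FreeAlgebra.ι ℤ 1) ^ k)
    (fun φ => by rw [map_pow, map_altPowers]; exact hA _ _) (fun i => if i = 0 then x else y)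
  rw [map_pow, map_altPowers, FreeAlgebra.lift_ι_apply, FreeAlgebra.lift_ι_apply,
    if_pos rfl, if_neg one_ne_zero] at hf
  have : NeZero m := ⟨by omega⟩
  have hunit := hxy.pow k
  rw [hf] at hunit
  exact not_isUnit_zero hunit

theorem toENat_rank_le_PIdeg {A : Type*} [Ring A] [Algebra ℂ A]
    (hA : Module.rank ℂ A ≤ Cardinal.aleph0) (V : Type*) [AddCommGroup V] [Module ℂ V]
    [Module A V] [IsScalarTower ℂ A V] [IsSimpleModule A V] :
    Cardinal.toENat (Module.rank ℂ V) ≤ PIdeg A := by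
  refine ENat.forall_natCast_le_iff_le.1 fun n hn => ?_
  obtain rfl | hpos := Nat.eq_zero_or_pos n
  · simp
  obtain ⟨b, hb⟩ := Module.le_rank_iff.1 (Cardinal.natCast_le_toENat.1 hn)
  exact le_iSup₂_of_le n ⟨hpos, fun f hf => isPolyId_matrix_of_linearIndependent hA hb hf⟩ le_rfl

end Main

/-- Let `A` be a unital `ℂ`-algebra of at most countable dimension which is
semiprimitive (the Jacobson radical, i.e. the intersection of the annihilators of all
simple left `A`-modules, vanishes) or left noetherian.  Then `PI.deg A` equals the
supremum, in `ℕ∞`, of `dim_ℂ V` over all simple left `A`-modules `V` (an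
infinite-dimensional simple module contributing `∞`). -/
theorem stmt6 (A : Type u) [Ring A] [Algebra ℂ A]
    (hcount : Module.rank ℂ A ≤ Cardinal.aleph0)
    (h : (∀ a : A, (∀ (V : Type u) [AddCommGroup V] [Module A V],
            IsSimpleModule A V → ∀ v : V, a • v = 0) → a = 0)
        ∨ IsNoetherianRing A) :
    PIdeg A = sSup {d : ℕ∞ | ∃ (V : Type u) (_ : AddCommGroup V) (_ : Module ℂ V)
      (_ : Module A V) (_ : IsScalarTower ℂ A V), IsSimpleModule A V ∧
        d = Cardinal.toENat (Module.rank ℂ V)} := by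
  apply le_antisymm
  · cases hd : sSup {d : ℕ∞ | ∃ (V : Type u) (_ : AddCommGroup V) (_ : Module ℂ V)
      (_ : Module A V) (_ : IsScalarTower ℂ A V), IsSimpleModule A V ∧
        d = Cardinal.toENat (Module.rank ℂ V)} with
    | top => exact le_top
    | coe d =>
      obtain ⟨k, hk⟩ := exists_pow_altPowers_eq_zero hcount h (d := d)
        fun V _ _ _ hT hV => hd ▸ le_sSup ⟨V, _, _, _, hT, hV, rfl⟩
      exact iSup₂_le fun m hm => Nat.cast_le.2 (le_of_pow_altPowers_eq_zero hk hm.1 hm.2)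
  · refine sSup_le ?_
    rintro _ ⟨V, _, _, _, _, hV, rfl⟩
    exact toENat_rank_le_PIdeg hcount V
end

section
/- Let H be a finite group acting on a unital ℂ-algebra A by ℂ-algebra automorphisms, let A^H denote the fixed-point subalgebra, and let V be a (left) A-module. Then Len_A(V) ≤ Len_{A^H}(V) ≤ |H| · Len_{A}(V), where V is regarded as an A^H-module by restriction of scalars. -/
/-- The fixed-point subring `A^H = {a ∈ A : h • a = a for all h ∈ H}` of a group (or
monoid) `H` acting on a ring `A` by ring automorphisms. -/
def fixedSubring (H : Type*) [Monoid H] (A : Type*) [Ring A] [MulSemiringAction H A] :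
    Subring A where
  carrier := {a : A | ∀ h : H, h • a = a}
  zero_mem' := fun h => smul_zero h
  one_mem' := fun h => smul_one h
  add_mem' := fun ha hb h => by rw [smul_add, ha h, hb h]
  neg_mem' := fun ha h => by rw [smul_neg, ha h]
  mul_mem' := fun ha hb h => by rw [smul_mul', ha h, hb h]

/-- The length `Len_R(V) ∈ ℕ∞` of a module: the supremum of the lengths `n` of strictly
increasing chains `0 = V₀ ⊊ V₁ ⊊ ⋯ ⊊ V_n = V` of `R`-submodules of `V`. -/
noncomputable def moduleLength (R V : Type*) [Ring R] [AddCommGroup V] [Module R V] :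
    ℕ∞ :=
  sSup {n : ℕ∞ | ∃ (m : ℕ) (c : Fin (m + 1) → Submodule R V),
    StrictMono c ∧ c 0 = ⊥ ∧ c (Fin.last m) = ⊤ ∧ n = (m : ℕ∞)}

theorem moduleLength_eq_length (R V : Type*) [Ring R] [AddCommGroup V] [Module R V] :
    moduleLength R V = Module.length R V := by
  apply le_antisymm
  · refine sSup_le ?_
    rintro _ ⟨m, c, hc, -, -, rfl⟩
    rw [← WithBot.coe_le_coe, Module.coe_length]
    exact Order.LTSeries.length_le_krullDim (LTSeries.mk m c hc)
  · rw [Module.length_eq_height, Order.height_eq_iSup_last_eq]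
    refine iSup₂_le fun p hp => ?_
    rcases Nat.eq_zero_or_pos p.length with h0 | hpos
    · simp [h0]
    · refine le_sSup ⟨p.length, fun i => if i = 0 then ⊥ else p i, ?_, by simp, ?_, rfl⟩
      · intro i j hij
        have hj : j ≠ 0 := (Fin.zero_le i |>.trans_lt hij).ne'
        by_cases hi : i = 0
        · simpa [hi, hj] using bot_le.trans_lt (p.strictMono hij)
        · simpa [hi, hj] using p.strictMono hij
      · have : Fin.last p.length ≠ 0 := by
          simp only [ne_eq, Fin.ext_iff, Fin.val_last, Fin.val_zero]
          omega
        simpa [this, RelSeries.last] using hp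

theorem Module.length_le_of_strictMono {R S V W : Type*} [Ring R] [Ring S] [AddCommGroup V]
    [AddCommGroup W] [Module R V] [Module S W] (f : Submodule R V → Submodule S W)
    (hf : StrictMono f) : Module.length R V ≤ Module.length S W := by
  rw [← WithBot.coe_le_coe, Module.coe_length, Module.coe_length]
  exact Order.krullDim_le_of_strictMono f hf

/-- The module `V` with the scalar action twisted by the automorphism `h`:
`a` acts as `h • a` does on `V`. -/
def TwistedModule {H : Type*} (_ : H) (V : Type*) : Type _ := V

namespace TwistedModule

variable {H A V : Type*} [AddCommGroup V]

instance (h : H) : AddCommGroup (TwistedModule h V) := inferInstanceAs (AddCommGroup V)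

/-- The diagonal embedding of `V` into the product of its twists. -/
def diag (H : Type*) {V : Type*} (v : V) : (h : H) → TwistedModule h V := fun _ => v

/-- The sum of the coordinates, taken in `V`. -/
def coordSum [Fintype H] (f : (h : H) → TwistedModule h V) : V := ∑ h, (show V from f h)

theorem coordSum_diag [Fintype H] (v : V) : coordSum (diag H v) = Fintype.card H • v :=
  (Finset.sum_const v).trans (by rw [Finset.card_univ])

variable [Group H] [Ring A] [MulSemiringAction H A] [Module A V]

instance (h : H) : Module A (TwistedModule h V) :=
  Module.compHom V (MulSemiringAction.toRingHom H A h)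

theorem length_le (h : H) : Module.length A (TwistedModule h V) ≤ Module.length A V :=
  Module.length_le_of_strictMono
    (fun U : Submodule A (TwistedModule h V) =>
      ({ U.toAddSubmonoid with
          smul_mem' := fun a v hv => by
            have hmem : ((h • h⁻¹ • a) • v : V) ∈ U.carrier := U.smul_mem (h⁻¹ • a) hv
            rwa [smul_inv_smul] at hmem } : Submodule A V))
    (fun _ _ hlt => hlt)

variable [Fintype H]

theorem coordSum_mem (U : Submodule (fixedSubring H A) V) {f : (h : H) → TwistedModule h V}
    (hf : f ∈ Submodule.span A (diag H '' (U : Set V))) : coordSum f ∈ U := by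
  suffices ∀ a : A, coordSum (a • f) ∈ U by simpa using this 1
  induction hf using Submodule.span_induction with
  | mem x hx =>
    obtain ⟨u, hu, rfl⟩ := hx
    intro a
    have htr : ∑ h : H, h • a ∈ fixedSubring H A := fun g => by
      rw [Finset.smul_sum]
      simp only [smul_smul]
      exact Fintype.sum_equiv (Equiv.mulLeft g) _ _ fun _ => rfl
    have key : coordSum (a • diag H u) = (⟨_, htr⟩ : fixedSubring H A) • u :=
      (Finset.sum_smul (f := fun h : H => h • a) (s := Finset.univ) (x := u)).symm
    rw [key]
    exact U.smul_mem _ hu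
  | zero =>
    intro a
    rw [smul_zero]
    have key : coordSum (0 : (h : H) → TwistedModule h V) = 0 :=
      Finset.sum_const_zero (M := V)
    rw [key]
    exact U.zero_mem
  | add x y _ _ hx hy =>
    intro a
    have key : coordSum (a • (x + y)) = coordSum (a • x) + coordSum (a • y) := by
      rw [smul_add]
      exact Finset.sum_add_distrib (M := V)
    rw [key]
    exact U.add_mem (hx a) (hy a)
  | smul b x _ hx =>
    intro a
    rw [smul_smul]
    exact hx (a * b)

theorem mem_of_diag_mem_span [Algebra ℂ A] [SMulCommClass H ℂ A]
    (U : Submodule (fixedSubring H A) V) {v : V}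
    (hv : diag H v ∈ Submodule.span A (diag H '' (U : Set V))) : v ∈ U := by
  have hsum := coordSum_mem U hv
  rw [coordSum_diag] at hsum
  let c : fixedSubring H A :=
    ⟨algebraMap ℂ A (Fintype.card H : ℂ)⁻¹, fun h => smul_algebraMap h _⟩
  have hc : c • (Fintype.card H • v) = v := by
    change algebraMap ℂ A (Fintype.card H : ℂ)⁻¹ • (Fintype.card H • v) = v
    rw [← Nat.cast_smul_eq_nsmul A, smul_smul, ← map_natCast (algebraMap ℂ A), ← map_mul,
      inv_mul_cancel₀ (Nat.cast_ne_zero.mpr Fintype.card_ne_zero), map_one, one_smul]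
  exact hc ▸ U.smul_mem c hsum

theorem strictMono_span_diag [Algebra ℂ A] [SMulCommClass H ℂ A] :
    StrictMono fun U : Submodule (fixedSubring H A) V =>
      Submodule.span A (diag H '' (U : Set V)) := by
  refine Monotone.strictMono_of_injective
    (fun U U' hle => Submodule.span_mono (Set.image_mono hle)) fun U U' heq => ?_
  have hle : ∀ {X Y : Submodule (fixedSubring H A) V},
      Submodule.span A (diag H '' (X : Set V)) = Submodule.span A (diag H '' (Y : Set V)) →
        X ≤ Y := fun hXY v hv =>
    mem_of_diag_mem_span _ (hXY ▸ Submodule.subset_span ⟨v, hv, rfl⟩)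
  exact le_antisymm (hle heq) (hle heq.symm)

end TwistedModule

/-- Let `H` be a finite group acting on a unital `ℂ`-algebra `A` by `ℂ`-algebra
automorphisms and let `V` be a left `A`-module.  Then
`Len_A(V) ≤ Len_{A^H}(V) ≤ |H| · Len_A(V)`, where `V` is an `A^H`-module by
restriction of scalars. -/
theorem stmt7 (H : Type*) [Group H] [Fintype H]
    (A : Type*) [Ring A] [Algebra ℂ A] [MulSemiringAction H A] [SMulCommClass H ℂ A]
    (V : Type*) [AddCommGroup V] [Module A V] :
    moduleLength A V ≤ moduleLength (fixedSubring H A) V ∧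
      moduleLength (fixedSubring H A) V ≤ (Fintype.card H : ℕ∞) * moduleLength A V := by
  simp only [moduleLength_eq_length]
  refine ⟨Module.length_le_of_strictMono (Submodule.restrictScalars (fixedSubring H A))
    fun _ _ hlt => hlt, ?_⟩
  calc Module.length (fixedSubring H A) V
      ≤ Module.length A ((h : H) → TwistedModule h V) :=
        Module.length_le_of_strictMono _ TwistedModule.strictMono_span_diag
    _ = ∑ h : H, Module.length A (TwistedModule h V) := Module.length_pi_of_fintype A _
    _ ≤ ∑ _h : H, Module.length A V := Finset.sum_le_sum fun h _ => TwistedModule.length_le h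
    _ = (Fintype.card H : ℕ∞) * Module.length A V := by simp
end

section
/- Let P be a Poisson ring and X, Y ∈ P. Then for all integers j ≥ i ≥ 1, q_i(X, Y; Y^j) = C(j, i) · q_i(X, Y; Y^i) · Y^{j−i} (where C(j, i) is the binomial coefficient), and for all i ≥ 2, q_i(X, Y; Y^i) = i · q_{i−1}(X, Y; Y^{i−1}) · ⁅Y, q_{i−1}(X, Y; Y^{i−1})⁆. -/
/-- The iterated Poisson-bracket expressions `q_i(X, Y; Z)` of the paper, for a
commutative ring equipped with a bracket `br`:
`q₁(X,Y;Z) = ⁅Z,X⁆` and `q_i(X,Y;Z) = ⁅q_{i-1}(X,Y;Z), q_{i-1}(X,Y;Y^{i-1})⁆`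
for `i ≥ 2`. -/
def qIter {P : Type*} [CommRing P] (br : P → P → P) (X Y : P) : ℕ → P → P
  | 0, Z => Z
  | 1, Z => br Z X
  | (i + 2), Z => br (qIter br X Y (i + 1) Z) (qIter br X Y (i + 1) (Y ^ (i + 1)))

/-- A biadditive alternating bracket satisfying the Leibniz rule in its second argument
acts by derivations in its first argument. -/
def bracketDerivation {P : Type*} [CommRing P] (br : P → P → P)
    (hadd_left : ∀ a b c : P, br (a + b) c = br a c + br b c)
    (hadd_right : ∀ a b c : P, br a (b + c) = br a b + br a c)
    (halt : ∀ a : P, br a a = 0)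
    (hleibniz : ∀ a b c : P, br a (b * c) = br a b * c + b * br a c)
    (w : P) : Derivation ℤ P P :=
  Derivation.mk' (AddMonoidHom.mk' (fun a => br a w) fun a b => hadd_left a b w).toIntLinearMap
    fun a b => by
      have hskew (x y : P) : br x y = -br y x := by
        have h := halt (x + y)
        rw [hadd_left, hadd_right, hadd_right, halt, halt] at h
        linear_combination h
      change br (a * b) w = a * br b w + b * br a w
      rw [hskew, hleibniz, hskew a w, hskew b w]
      ring

/-- A derivation `D` with `D q = 0` sends `c * q * Y ^ n` to `n * c * q * Y ^ (n - 1) * D Y`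
for every natural number `c`. -/
theorem Derivation.natCast_mul_mul_pow {P : Type*} [CommRing P] (D : Derivation ℤ P P)
    {q : P} (hq : D q = 0) (Y : P) (c n : ℕ) :
    D ((c : P) * q * Y ^ n) = (n : P) * c * q * Y ^ (n - 1) * D Y := by
  simp only [Derivation.leibniz, Derivation.leibniz_pow, Derivation.map_natCast, hq,
    smul_eq_mul, nsmul_eq_mul]
  ring

/-- Let `P` be a Poisson ring (a commutative ring with a biadditive alternating bracket
satisfying the Jacobi identity in Leibniz form and the Leibniz rule) and `X, Y ∈ P`.
Then for all `j ≥ i ≥ 1` one has `q_i(X,Y;Y^j) = C(j,i) · q_i(X,Y;Y^i) · Y^(j-i)`, and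
for all `i ≥ 2`, `q_i(X,Y;Y^i) = i · q_{i-1}(X,Y;Y^{i-1}) · ⁅Y, q_{i-1}(X,Y;Y^{i-1})⁆`. -/
theorem stmt11 (P : Type*) [CommRing P] (br : P → P → P)
    (hadd_left : ∀ a b c : P, br (a + b) c = br a c + br b c)
    (hadd_right : ∀ a b c : P, br a (b + c) = br a b + br a c)
    (halt : ∀ a : P, br a a = 0)
    (hjacobi : ∀ a b c : P, br a (br b c) = br (br a b) c + br b (br a c))
    (hleibniz : ∀ a b c : P, br a (b * c) = br a b * c + b * br a c)
    (X Y : P) :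
    (∀ i j : ℕ, 1 ≤ i → i ≤ j →
      qIter br X Y i (Y ^ j) = (j.choose i : P) * qIter br X Y i (Y ^ i) * Y ^ (j - i)) ∧
    (∀ i : ℕ, 2 ≤ i →
      qIter br X Y i (Y ^ i) =
        (i : P) * qIter br X Y (i - 1) (Y ^ (i - 1)) *
          br Y (qIter br X Y (i - 1) (Y ^ (i - 1)))) := by
  let D := bracketDerivation br hadd_left hadd_right halt hleibniz
  have hstep (i j : ℕ)
      (h : qIter br X Y (i + 1) (Y ^ j) =
        (j.choose (i + 1) : P) * qIter br X Y (i + 1) (Y ^ (i + 1)) * Y ^ (j - (i + 1))) :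
      qIter br X Y (i + 2) (Y ^ j) =
        ((j - (i + 1) : ℕ) : P) * (j.choose (i + 1) : P) * qIter br X Y (i + 1) (Y ^ (i + 1)) *
          Y ^ (j - (i + 1) - 1) * br Y (qIter br X Y (i + 1) (Y ^ (i + 1))) := by
    rw [qIter, h]
    exact (D (qIter br X Y (i + 1) (Y ^ (i + 1)))).natCast_mul_mul_pow (halt _) Y _ _
  have hpow (i : ℕ) : ∀ j, i + 1 ≤ j → qIter br X Y (i + 1) (Y ^ j) =
      (j.choose (i + 1) : P) * qIter br X Y (i + 1) (Y ^ (i + 1)) * Y ^ (j - (i + 1)) := by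
    induction i with
    | zero =>
      intro j _
      have h : br (Y ^ j) X = _ := (D X).leibniz_pow Y j
      simp only [smul_eq_mul, nsmul_eq_mul] at h
      simp only [zero_add, qIter, pow_one, Nat.choose_one_right, h]
      change (j : P) * (Y ^ (j - 1) * br Y X) = _
      ring
    | succ i ih =>
      intro j hj
      have hchoose : (j.choose (i + 2) : P) * ((i + 2 : ℕ) : P) =
          (j.choose (i + 1) : P) * ((j - (i + 1) : ℕ) : P) := by
        exact_mod_cast congrArg (Nat.cast (R := P)) (Nat.choose_succ_right_eq j (i + 1))
      rw [hstep i j (ih j (by lia)), hstep i (i + 2) (ih (i + 2) (by lia)),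
        Nat.choose_succ_self_right (i + 1)]
      simp only [Nat.sub_sub, show i + 2 - (i + 1) = 1 by lia, Nat.cast_one]
      linear_combination
        -qIter br X Y (i + 1) (Y ^ (i + 1)) * Y ^ (j - (i + 2)) *
          br Y (qIter br X Y (i + 1) (Y ^ (i + 1))) * hchoose
  refine ⟨fun i j hi hij => ?_, fun i hi => ?_⟩
  · obtain ⟨i, rfl⟩ := Nat.exists_eq_add_of_le' hi
    exact hpow i j hij
  · obtain ⟨i, rfl⟩ := Nat.exists_eq_add_of_le' hi
    rw [hstep i (i + 2) (hpow i (i + 2) (by lia)), Nat.choose_succ_self_right (i + 1)]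
    simp only [show i + 2 - (i + 1) = 1 by lia, Nat.cast_one, one_mul, Nat.sub_self, pow_zero,
      mul_one, show i + 2 - 1 = i + 1 by lia]
end
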